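/- For every Barański sponge Λ_Φ, the Hausdorff dimension of Λ_Φ equals the supremum of the Hausdorff dimensions of its pseudo-Bernoulli measures: HD(Λ_Φ) = sup_{r∈R} HD(ν_r). -/

import Mathlib

open MeasureTheory Filter Set Metric
open scoped Classical Topology ENNReal NNReal

namespace SelfAffineSponge

/-- A diagonal IFS on `[0,1]^d`: for each coordinate `i ∈ D = Fin d` a finite alphabet
`A i` indexing affine maps `x ↦ slope i a * x + off i a` of `[0,1]`, together with a
set `E ⊆ ∏ i, A i` of allowed tuples of symbols. -/
structure DiagIFS (d : ℕ) (A : Fin d → Type) [∀ i, Fintype (A i)] where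
  slope : ∀ i : Fin d, A i → ℝ
  off : ∀ i : Fin d, A i → ℝ
  E : Finset (∀ i, A i)

variable {d : ℕ} {A : Fin d → Type} [∀ i, Fintype (A i)]

namespace DiagIFS

/-- the base similarity `φ_{i,a}` in coordinate `i` -/
def base (Φ : DiagIFS d A) (i : Fin d) (a : A i) (x : ℝ) : ℝ :=
  Φ.slope i a * x + Φ.off i a

/-- the data defines an honest diagonal IFS: `E` is nonempty and each base map is a
contracting similarity of `[0,1]` -/
def Valid (Φ : DiagIFS d A) : Prop :=
  Φ.E.Nonempty ∧ (∀ i a, Φ.slope i a ≠ 0) ∧ (∀ i a, |Φ.slope i a| < 1) ∧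
    ∀ i a, ∀ x ∈ Set.Icc (0:ℝ) 1, Φ.base i a x ∈ Set.Icc (0:ℝ) 1

/-- the alphabet `E` of the IFS, as a type -/
abbrev Symb (Φ : DiagIFS d A) : Type _ := {a : ∀ i, A i // a ∈ Φ.E}

instance (Φ : DiagIFS d A) : MeasurableSpace Φ.Symb := ⊤
instance (Φ : DiagIFS d A) : TopologicalSpace Φ.Symb := ⊥

/-- the affine contraction `φ_a` of `[0,1]^d` associated to a tuple of symbols -/
def affMap (Φ : DiagIFS d A) (a : ∀ i, A i) (x : Fin d → ℝ) : Fin d → ℝ :=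
  fun i => Φ.base i (a i) (x i)

/-- the coding map `π(ω) = lim_n φ_{ω_0}∘⋯∘φ_{ω_{n-1}}(0)`, written in closed form -/
noncomputable def coding (Φ : DiagIFS d A) (ω : ℕ → Φ.Symb) : Fin d → ℝ :=
  fun i => ∑' n : ℕ, (∏ k ∈ Finset.range n, Φ.slope i ((ω k).1 i)) * Φ.off i ((ω n).1 i)

/-- the limit set `Λ_Φ = π(E^ℕ)` (the self-affine sponge) -/
def limitSet (Φ : DiagIFS d A) : Set (Fin d → ℝ) :=
  Set.range Φ.coding

theorem coding_mem (Φ : DiagIFS d A) (ω : ℕ → Φ.Symb) : Φ.coding ω ∈ Φ.limitSet :=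
  ⟨ω, rfl⟩

/-- the `i`-th Lyapunov exponent `χ_i(p) = -∫ log|φ'_{a,i}| dp(a)` of a finite measure
`p` on `E` (given by its density) -/
noncomputable def chi (Φ : DiagIFS d A) (i : Fin d) (p : Φ.Symb → ℝ) : ℝ :=
  -∑ a : Φ.Symb, p a * Real.log |Φ.slope i (a.1 i)|

/-- the mass `p([a]_I)` of the cylinder `[a]_I = {b ∈ E : b_i = a_i ∀ i ∈ I}` -/
noncomputable def cylMass (Φ : DiagIFS d A) (I : Finset (Fin d)) (p : Φ.Symb → ℝ)
    (a : Φ.Symb) : ℝ :=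
  ∑ b : Φ.Symb, if ∀ i ∈ I, b.1 i = a.1 i then p b else 0

/-- the entropy `h(I; p) = -∫ log p([a]_I) dp(a)` -/
noncomputable def entropy (Φ : DiagIFS d A) (I : Finset (Fin d)) (p : Φ.Symb → ℝ) : ℝ :=
  -∑ a : Φ.Symb, p a * Real.log (Φ.cylMass I p a)

/-- the conditional entropy `h(I' | I; p) = h(I';p) - h(I;p)` -/
noncomputable def condEntropy (Φ : DiagIFS d A) (I I' : Finset (Fin d))
    (p : Φ.Symb → ℝ) : ℝ :=
  Φ.entropy I' p - Φ.entropy I p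

/-- a coordinate set `I ⊆ D` is good if the projected IFS `Φ_I` satisfies the open set
condition: the boxes `φ_{I,a}((0,1)^I)`, indexed by distinct projections of elements of
`E`, are pairwise disjoint (equivalently, some coordinate has disjoint intervals). -/
def GoodIdx (Φ : DiagIFS d A) (I : Finset (Fin d)) : Prop :=
  ∀ a ∈ Φ.E, ∀ b ∈ Φ.E, (∃ i ∈ I, a i ≠ b i) →
    ∃ i ∈ I, Disjoint (Φ.base i (a i) '' Set.Ioo (0:ℝ) 1)
      (Φ.base i (b i) '' Set.Ioo (0:ℝ) 1)

/-- Barański condition: each base IFS satisfies the open set condition w.r.t. `(0,1)` -/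
def Baranski (Φ : DiagIFS d A) : Prop :=
  ∀ i : Fin d, ∀ a b : A i, a ≠ b →
    Disjoint (Φ.base i a '' Set.Ioo (0:ℝ) 1) (Φ.base i b '' Set.Ioo (0:ℝ) 1)

/-- strong Barański condition: each base IFS satisfies the strong separation condition
w.r.t. `[0,1]` -/
def StronglyBaranski (Φ : DiagIFS d A) : Prop :=
  ∀ i : Fin d, ∀ a b : A i, a ≠ b →
    Disjoint (Φ.base i a '' Set.Icc (0:ℝ) 1) (Φ.base i b '' Set.Icc (0:ℝ) 1)

/-- coordinate ordering condition: some permutation `σ` of the coordinates has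
`|φ'_{a,σ(1)}| > ⋯ > |φ'_{a,σ(d)}|` for all `a ∈ E` -/
def CoordOrdering (Φ : DiagIFS d A) : Prop :=
  ∃ σ : Equiv.Perm (Fin d), ∀ a ∈ Φ.E, ∀ i j : Fin d, i < j →
    |Φ.slope (σ j) (a (σ j))| < |Φ.slope (σ i) (a (σ i))|

end DiagIFS

/-- a probability vector (probability measure on a finite set, via its density) -/
def IsProbVec {α : Type*} [Fintype α] (p : α → ℝ) : Prop :=
  (∀ a, 0 ≤ p a) ∧ ∑ a, p a = 1

/-- a measure `p` on `E` is good if `I(p,x) = {i : χ_i(p) ≤ x}` is good for all `x > 0` -/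
def DiagIFS.GoodVec (Φ : DiagIFS d A) (p : Φ.Symb → ℝ) : Prop :=
  ∀ x > 0, Φ.GoodIdx (Finset.univ.filter fun i => Φ.chi i p ≤ x)

/-- a cycle on `E`: a continuous exponentially `λ`-periodic map `(0,∞) → P`,
where `λ = 1` means constant -/
structure Cycle (Φ : DiagIFS d A) where
  lam : ℝ
  one_le_lam : 1 ≤ lam
  r : ℝ → Φ.Symb → ℝ
  prob : ∀ b > 0, IsProbVec (r b)
  cont : ContinuousOn r (Set.Ioi 0)
  periodic : ∀ b > 0, r (lam * b) = r b
  const_of_lam_eq_one : lam = 1 → ∀ b > 0, ∀ b' > 0, r b = r b'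

/-- the number `B_i`, determined by `B = ∫_0^{B_i} χ_i(r_b) db` (written via `sInf`;
for a cycle the function `x ↦ ∫_0^x χ_i(r_b) db` is continuous and strictly
increasing, so the infimum is the unique solution) -/
noncomputable def Bcoord (Φ : DiagIFS d A) (r : ℝ → Φ.Symb → ℝ) (B : ℝ) (i : Fin d) : ℝ :=
  sInf {x : ℝ | 0 ≤ x ∧ B ≤ ∫ b in Set.Ioc (0:ℝ) x, Φ.chi i (r b)}

/-- `δ(r, B) = B⁻¹ ∫_0^∞ h({i : b ≤ B_i}; r_b) db` -/
noncomputable def deltaRB (Φ : DiagIFS d A) (r : ℝ → Φ.Symb → ℝ) (B : ℝ) : ℝ :=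
  B⁻¹ * ∫ b in Set.Ioi (0:ℝ),
    Φ.entropy (Finset.univ.filter fun i => b ≤ Bcoord Φ r B i) (r b)

/-- `δ(r) = inf_{B ∈ [1,λ]} δ(r,B)` -/
noncomputable def Cycle.delta {Φ : DiagIFS d A} (c : Cycle Φ) : ℝ :=
  sInf (deltaRB Φ c.r '' Set.Icc 1 c.lam)

/-- `δ(p) = ∫_0^∞ h({i : b ≤ 1/χ_i(p)}; p) db` -/
noncomputable def deltaP (Φ : DiagIFS d A) (p : Φ.Symb → ℝ) : ℝ :=
  ∫ b in Set.Ioi (0:ℝ),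
    Φ.entropy (Finset.univ.filter fun i => b ≤ (Φ.chi i p)⁻¹) p

/-- the normalized average `R̂_B = B⁻¹ ∫_0^B r_b db` of a cycle -/
noncomputable def cycleAvg {Φ : DiagIFS d A} (c : Cycle Φ) (B : ℝ) : Φ.Symb → ℝ :=
  fun a => B⁻¹ * ∫ b in Set.Ioc (0:ℝ) B, c.r b a

/-- a cycle is good if all its normalized averages `R̂_B` are good -/
def Cycle.Good {Φ : DiagIFS d A} (c : Cycle Φ) : Prop :=
  ∀ B > 0, Φ.GoodVec (cycleAvg c B)

/-- a cycle is nondegenerate if `{b > 0 : r_b(a) > 0 ∀ a ∈ E_r}` is dense in `(0,∞)` -/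
def Cycle.Nondeg {Φ : DiagIFS d A} (c : Cycle Φ) : Prop :=
  Set.Ioi (0:ℝ) ⊆
    closure {b : ℝ | 0 < b ∧ ∀ a : Φ.Symb, (∃ b' > 0, 0 < c.r b' a) → 0 < c.r b a}

/-- the lower pointwise dimension `d̲(x,μ) = liminf_{ρ→0} log μ(B(x,ρ))/log ρ` -/
noncomputable def lowerPtDim {X : Type*} [PseudoMetricSpace X] [MeasurableSpace X]
    (μ : Measure X) (x : X) : ℝ≥0∞ :=
  Filter.liminf
    (fun ρ : ℝ => ENNReal.ofReal (Real.log (μ (Metric.ball x ρ)).toReal / Real.log ρ))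
    (𝓝[>] (0:ℝ))

/-- the Hausdorff dimension of a measure: the essential supremum of its lower
pointwise dimension -/
noncomputable def measDim {X : Type*} [PseudoMetricSpace X] [MeasurableSpace X]
    (μ : Measure X) : ℝ≥0∞ :=
  essSup (lowerPtDim μ) μ

/-- the shift map on `E^ℕ` -/
def shift {α : Type*} (ω : ℕ → α) : ℕ → α := fun n => ω (n + 1)

/-- the dynamical dimension: the supremum of `HD(π_*μ)` over shift-invariant
probability measures `μ` on `E^ℕ` -/
noncomputable def DiagIFS.dynDim (Φ : DiagIFS d A) : ℝ≥0∞ :=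
  sSup {x : ℝ≥0∞ | ∃ μ : Measure (ℕ → Φ.Symb), IsProbabilityMeasure μ ∧
    Measure.map shift μ = μ ∧ x = measDim (Measure.map Φ.coding μ)}

/-- `μ` is the product measure on `E^ℕ` whose `k`-th factor has density `p k`
(this property characterizes `μ` uniquely) -/
def IsProductMeasure (Φ : DiagIFS d A) (p : ℕ → Φ.Symb → ℝ)
    (μ : Measure (ℕ → Φ.Symb)) : Prop :=
  IsProbabilityMeasure μ ∧
    ∀ (n : ℕ) (w : ℕ → Φ.Symb),
      (μ {ω | ∀ k < n, ω k = w k}).toReal = ∏ k ∈ Finset.range n, p k (w k)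

/-- the set of Hausdorff dimensions of Bernoulli measures `ν_p = π_*[p^ℕ]` -/
noncomputable def bernoulliDims (Φ : DiagIFS d A) : Set ℝ≥0∞ :=
  {x | ∃ p : Φ.Symb → ℝ, IsProbVec p ∧ ∃ μ : Measure (ℕ → Φ.Symb),
    IsProductMeasure Φ (fun _ => p) μ ∧ x = measDim (Measure.map Φ.coding μ)}

/-- the set of Hausdorff dimensions of pseudo-Bernoulli measures
`ν_r = π_*[∏_n r_n]` -/
noncomputable def pseudoBernoulliDims (Φ : DiagIFS d A) : Set ℝ≥0∞ :=
  {x | ∃ c : Cycle Φ, ∃ μ : Measure (ℕ → Φ.Symb),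
    IsProductMeasure Φ (fun n => c.r ((n : ℝ) + 1)) μ ∧
      x = measDim (Measure.map Φ.coding μ)}

/-- The mass distribution principle. -/
theorem measDim_le_dimH {X : Type*} [MetricSpace X] [MeasurableSpace X] [BorelSpace X]
    (ν : Measure X) [IsFiniteMeasure ν] {Λ : Set X} (hΛ : ν Λᶜ = 0) :
    measDim ν ≤ dimH Λ := by
  refine le_of_forall_lt fun c hc => ?_
  obtain ⟨s, hcs, hs⟩ := ENNReal.lt_iff_exists_nnreal_btwn.1 hc
  refine hcs.trans_le ?_
  have hs0 : (0 : ℝ) < s := by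
    have : (0 : ℝ≥0∞) < s := (zero_le).trans_lt hcs
    exact_mod_cast this
  have h1 : ν {x | (s : ℝ≥0∞) < lowerPtDim ν x} ≠ 0 := by
    intro h0
    refine absurd (essSup_le_of_ae_le (f := lowerPtDim ν) (μ := ν) (s : ℝ≥0∞) ?_) (not_le.2 hs)
    rw [EventuallyLE, ae_iff]
    simpa using h0
  let F : ℕ → Set X := fun n =>
    {x | ∀ ρ ∈ Ioo (0 : ℝ) (1 / ((n : ℝ) + 1)), ν (ball x ρ) ≤ ENNReal.ofReal (ρ ^ (s : ℝ))}
  have h2 : {x | (s : ℝ≥0∞) < lowerPtDim ν x} ⊆ ⋃ n, F n := by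
    intro x hx
    have hev := eventually_lt_of_lt_liminf (show (s : ℝ≥0∞) < liminf _ _ from hx)
    obtain ⟨ε, hε, hεs⟩ := mem_nhdsGT_iff_exists_Ioo_subset.1 hev
    have hε0 : (0 : ℝ) < ε := hε
    obtain ⟨n, hn⟩ := exists_nat_one_div_lt (lt_min hε0 one_pos)
    refine mem_iUnion.2 ⟨n, fun ρ hρ => ?_⟩
    have hρ1 : ρ < 1 := hρ.2.trans (hn.trans_le (min_le_right _ _))
    have hlt := hεs ⟨hρ.1, hρ.2.trans (hn.trans_le (min_le_left _ _))⟩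
    have hlt' : (s : ℝ) < Real.log (ν (ball x ρ)).toReal / Real.log ρ := by
      have := (ENNReal.lt_ofReal_iff_toReal_lt ENNReal.coe_ne_top).1 hlt
      simpa using this
    have hlog : Real.log ρ < 0 := Real.log_neg hρ.1 hρ1
    rw [lt_div_iff_of_neg hlog] at hlt'
    rw [← ENNReal.ofReal_toReal (measure_ne_top ν (ball x ρ))]
    refine ENNReal.ofReal_le_ofReal ?_
    rcases (ENNReal.toReal_nonneg (a := ν (ball x ρ))).eq_or_lt with h0 | h0
    · rw [← h0]; exact Real.rpow_nonneg hρ.1.le _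
    · rw [← Real.exp_log h0, Real.rpow_def_of_pos hρ.1]
      exact Real.exp_le_exp.2 (by linarith [mul_comm (Real.log ρ) s])
  have h3 : ∃ n, ν (F n ∩ Λ) ≠ 0 := by
    by_contra! hcon
    refine h1 (measure_mono_null (t := (⋃ n, (F n ∩ Λ)) ∪ Λᶜ) ?_ ?_)
    · intro x hx
      by_cases hxΛ : x ∈ Λ
      · obtain ⟨n, hn⟩ := mem_iUnion.1 (h2 hx)
        exact Or.inl (mem_iUnion.2 ⟨n, hn, hxΛ⟩)
      · exact Or.inr hxΛ
    · exact measure_union_null (measure_iUnion_null hcon) hΛ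
  obtain ⟨n, hn⟩ := h3
  set G := F n ∩ Λ with hG
  set a : ℝ := 1 / ((n : ℝ) + 1) with ha
  have ha0 : 0 < a := by positivity
  have hK : ENNReal.ofReal ((2 : ℝ) ^ (s : ℝ)) ≠ 0 := by
    simp only [ne_eq, ENNReal.ofReal_eq_zero, not_le]; positivity
  have key : ∀ U : Set X, ediam U ≤ ENNReal.ofReal (a / 3) →
      (ν.restrict G) U ≤ ENNReal.ofReal ((2 : ℝ) ^ (s : ℝ)) * ediam U ^ (s : ℝ) := by
    intro U hU
    rcases U.eq_empty_or_nonempty with rfl | ⟨x, hx⟩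
    · simp
    have hfin : ediam U ≠ ⊤ := ne_top_of_le_ne_top ENNReal.ofReal_ne_top hU
    set D := (ediam U).toReal with hD
    have hD0 : 0 ≤ D := ENNReal.toReal_nonneg
    have hDa : D ≤ a / 3 := ENNReal.toReal_le_of_le_ofReal (by positivity) hU
    have hsub : U ⊆ closedBall x D := by
      intro y hy
      rw [mem_closedBall, dist_edist]
      exact ENNReal.toReal_mono hfin (edist_le_ediam_of_mem hy hx)
    refine (measure_mono hsub).trans ?_
    rw [Measure.restrict_apply measurableSet_closedBall]
    rcases (closedBall x D ∩ G).eq_empty_or_nonempty with he | ⟨y, hy, hyG⟩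
    · simp [he]
    have hb : ∀ ρ ∈ Ioo (2 * D) a, ν (closedBall x D ∩ G) ≤ ENNReal.ofReal (ρ ^ (s : ℝ)) := by
      intro ρ hρ
      refine (measure_mono (t := ball y ρ) ?_).trans (hyG.1 ρ ⟨by linarith [hρ.1], hρ.2⟩)
      intro z hz
      have h1 : dist z x ≤ D := hz.1
      have h2 : dist y x ≤ D := hy
      rw [mem_ball]
      linarith [dist_triangle_right z y x, hρ.1]
    have hlim : Tendsto (fun ρ : ℝ => ENNReal.ofReal (ρ ^ (s : ℝ))) (𝓝[>] (2 * D))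
        (𝓝 (ENNReal.ofReal ((2 * D) ^ (s : ℝ)))) :=
      ((ENNReal.continuous_ofReal.comp (Real.continuous_rpow_const hs0.le)).tendsto _).mono_left
        nhdsWithin_le_nhds
    have hle := ge_of_tendsto hlim (Filter.eventually_of_mem
      (Ioo_mem_nhdsGT (by linarith)) hb)
    refine hle.trans (le_of_eq ?_)
    rw [Real.mul_rpow (by norm_num) hD0, ENNReal.ofReal_mul (by positivity),
      ← ENNReal.ofReal_rpow_of_nonneg hD0 hs0.le, hD, ENNReal.ofReal_toReal hfin]
  have hmain : (ENNReal.ofReal ((2 : ℝ) ^ (s : ℝ)))⁻¹ • ν.restrict G ≤ μH[(s : ℝ)] := by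
    refine Measure.le_hausdorffMeasure s _ (ENNReal.ofReal (a / 3)) (by simp [ha0]) fun U hU => ?_
    rw [Measure.smul_apply, smul_eq_mul, ENNReal.inv_mul_le_iff hK ENNReal.ofReal_ne_top]
    exact key U hU
  refine le_dimH_of_hausdorffMeasure_ne_zero fun h0 => ?_
  have h5 := hmain Λ
  rw [h0, Measure.smul_apply, smul_eq_mul, nonpos_iff_eq_zero, mul_eq_zero] at h5
  rcases h5 with h5 | h5
  · exact absurd h5 (ENNReal.inv_ne_zero.2 ENNReal.ofReal_ne_top)
  · refine hn (le_antisymm ?_ (zero_le))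
    calc ν G ≤ ν (Λ ∩ G) := measure_mono fun x hx => ⟨hx.2, hx⟩
      _ ≤ ν.restrict G Λ := Measure.le_restrict_apply _ _
      _ = 0 := h5

namespace DiagIFS

/-- The logarithmic contraction rate `-log |φ'_{i,a_i}|` of a symbol in coordinate `i`. -/
noncomputable def rate (Φ : DiagIFS d A) (i : Fin d) (a : Φ.Symb) : ℝ :=
  -Real.log |Φ.slope i (a.1 i)|

/-- The accumulated logarithmic contraction of the first `k` symbols in coordinate `i`. -/
noncomputable def rateSum (Φ : DiagIFS d A) (i : Fin d) (ω : ℕ → Φ.Symb) (k : ℕ) : ℝ :=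
  ∑ j ∈ Finset.range k, Φ.rate i (ω j)

/-- The composition `φ_{i,ω_0} ∘ ⋯ ∘ φ_{i,ω_{n-1}}`. -/
noncomputable def comp (Φ : DiagIFS d A) (i : Fin d) (ω : ℕ → Φ.Symb) : ℕ → ℝ → ℝ
  | 0, x => x
  | n + 1, x => comp Φ i ω n (Φ.base i ((ω n).1 i) x)

/-- Two-sided bounds for the contraction rates. -/
structure RateBound (Φ : DiagIFS d A) (c C : ℝ) : Prop where
  pos : 0 < c
  le_one : c ≤ 1
  one_le : 1 ≤ C
  lower : ∀ i a, c ≤ Φ.rate i a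
  upper : ∀ i a, Φ.rate i a ≤ C

variable {Φ : DiagIFS d A}

theorem Valid.rate_pos (hV : Φ.Valid) (i : Fin d) (a : Φ.Symb) : 0 < Φ.rate i a :=
  neg_pos.2 (Real.log_neg (abs_pos.2 (hV.2.1 _ _)) (hV.2.2.1 _ _))

theorem Valid.exists_rateBound (hV : Φ.Valid) : ∃ c C, Φ.RateBound c C := by
  obtain ⟨C, hC⟩ := (Set.finite_range fun x : Fin d × Φ.Symb => Φ.rate x.1 x.2).bddAbove
  obtain ⟨D, hD⟩ := (Set.finite_range fun x : Fin d × Φ.Symb => (Φ.rate x.1 x.2)⁻¹).bddAbove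
  have hD1 : 0 < max D 1 := lt_max_of_lt_right one_pos
  refine ⟨(max D 1)⁻¹, max C 1, inv_pos.2 hD1, inv_le_one_of_one_le₀ (le_max_right _ _),
    le_max_right _ _, fun i a => ?_, fun i a => ?_⟩
  · rw [inv_le_comm₀ hD1 (hV.rate_pos i a)]
    exact (hD ⟨(i, a), rfl⟩).trans (le_max_left _ _)
  · exact (hC ⟨(i, a), rfl⟩).trans (le_max_left _ _)

theorem rateSum_succ (i : Fin d) (ω : ℕ → Φ.Symb) (k : ℕ) :
    Φ.rateSum i ω (k + 1) = Φ.rateSum i ω k + Φ.rate i (ω k) :=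
  Finset.sum_range_succ _ _

theorem RateBound.mul_le_rateSum {c C : ℝ} (h : Φ.RateBound c C) (i : Fin d) (ω : ℕ → Φ.Symb)
    (k : ℕ) : c * k ≤ Φ.rateSum i ω k := by
  have := Finset.card_nsmul_le_sum (Finset.range k) (fun j => Φ.rate i (ω j)) c
    fun j _ => h.lower i _
  simpa [rateSum, mul_comm] using this

theorem Valid.rateSum_mono (hV : Φ.Valid) (i : Fin d) (ω : ℕ → Φ.Symb) :
    Monotone (Φ.rateSum i ω) :=
  monotone_nat_of_le_succ fun k => by
    rw [rateSum_succ]; linarith [hV.rate_pos i (ω k)]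

theorem rateSum_congr {i : Fin d} {ω σ : ℕ → Φ.Symb} {k : ℕ}
    (h : ∀ j < k, (σ j).1 i = (ω j).1 i) : Φ.rateSum i σ k = Φ.rateSum i ω k :=
  Finset.sum_congr rfl fun j hj => by simp only [rate, h j (Finset.mem_range.1 hj)]

theorem Valid.abs_prod_slope (hV : Φ.Valid) (i : Fin d) (ω : ℕ → Φ.Symb) (k : ℕ) :
    |∏ j ∈ Finset.range k, Φ.slope i ((ω j).1 i)| = Real.exp (-Φ.rateSum i ω k) := by
  rw [Finset.abs_prod, rateSum, ← Finset.sum_neg_distrib, Real.exp_sum]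
  refine Finset.prod_congr rfl fun j _ => ?_
  rw [rate, neg_neg, Real.exp_log (abs_pos.2 (hV.2.1 _ _))]

theorem comp_eq (i : Fin d) (ω : ℕ → Φ.Symb) (n : ℕ) (x : ℝ) :
    Φ.comp i ω n x =
      ∑ k ∈ Finset.range n, (∏ j ∈ Finset.range k, Φ.slope i ((ω j).1 i)) * Φ.off i ((ω k).1 i) +
        (∏ j ∈ Finset.range n, Φ.slope i ((ω j).1 i)) * x := by
  induction n generalizing x with
  | zero => simp [comp]
  | succ n ih =>
    rw [comp, ih, Finset.sum_range_succ, Finset.prod_range_succ, base]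
    ring

theorem comp_add (i : Fin d) (ω : ℕ → Φ.Symb) (k n : ℕ) (x : ℝ) :
    Φ.comp i ω (k + n) x = Φ.comp i ω k (Φ.comp i (fun j => ω (k + j)) n x) := by
  induction n generalizing x with
  | zero => rfl
  | succ n ih => rw [← add_assoc, comp, ih]; rfl

theorem comp_congr {i : Fin d} {ω σ : ℕ → Φ.Symb} {n : ℕ}
    (h : ∀ j < n, (σ j).1 i = (ω j).1 i) (x : ℝ) : Φ.comp i σ n x = Φ.comp i ω n x := by
  induction n generalizing x with
  | zero => rfl
  | succ n ih =>
    rw [comp, comp, h n n.lt_succ_self, ih fun j hj => h j (hj.trans n.lt_succ_self)]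

theorem Valid.comp_mem_Icc (hV : Φ.Valid) (i : Fin d) (ω : ℕ → Φ.Symb) (n : ℕ) {x : ℝ}
    (hx : x ∈ Icc (0 : ℝ) 1) : Φ.comp i ω n x ∈ Icc (0 : ℝ) 1 := by
  induction n generalizing x with
  | zero => exact hx
  | succ n ih => exact ih (hV.2.2.2 _ _ _ hx)

theorem Valid.base_mem_Ioo (hV : Φ.Valid) (i : Fin d) (a : A i) {x : ℝ}
    (hx : x ∈ Ioo (0 : ℝ) 1) : Φ.base i a x ∈ Ioo (0 : ℝ) 1 := by
  have h0 := hV.2.2.2 i a 0 ⟨le_rfl, zero_le_one⟩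
  have h1 := hV.2.2.2 i a 1 ⟨zero_le_one, le_rfl⟩
  have hs := hV.2.1 i a
  simp only [base, mem_Icc, mem_Ioo, mul_zero, zero_add, mul_one] at *
  rcases lt_or_gt_of_ne hs with h | h <;> constructor <;> nlinarith [hx.1, hx.2]

theorem Valid.comp_mem_Ioo (hV : Φ.Valid) (i : Fin d) (ω : ℕ → Φ.Symb) (n : ℕ) {x : ℝ}
    (hx : x ∈ Ioo (0 : ℝ) 1) : Φ.comp i ω n x ∈ Ioo (0 : ℝ) 1 := by
  induction n generalizing x with
  | zero => exact hx
  | succ n ih => exact ih (hV.base_mem_Ioo _ _ hx)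

theorem Valid.summable_coding (hV : Φ.Valid) (i : Fin d) (ω : ℕ → Φ.Symb) :
    Summable fun n : ℕ =>
      (∏ k ∈ Finset.range n, Φ.slope i ((ω k).1 i)) * Φ.off i ((ω n).1 i) := by
  obtain ⟨c, C, h⟩ := hV.exists_rateBound
  have hc : Real.exp (-c) < 1 :=
    Real.exp_lt_one_iff.2 (neg_lt_zero.2 h.pos)
  refine Summable.of_norm_bounded (summable_geometric_of_lt_one (Real.exp_pos _).le hc) fun n => ?_
  have ho := hV.2.2.2 i ((ω n).1 i) 0 ⟨le_rfl, zero_le_one⟩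
  simp only [base, mul_zero, zero_add] at ho
  rw [norm_mul, Real.norm_eq_abs, Real.norm_eq_abs, hV.abs_prod_slope, abs_of_nonneg ho.1,
    ← Real.exp_nat_mul]
  calc _ ≤ Real.exp (-Φ.rateSum i ω n) * 1 := by gcongr; exact ho.2
    _ ≤ _ := by
      rw [mul_one, Real.exp_le_exp]
      linarith [h.mul_le_rateSum i ω n]

theorem Valid.coding_eq_comp (hV : Φ.Valid) (i : Fin d) (ω : ℕ → Φ.Symb) (n : ℕ) :
    Φ.coding ω i = Φ.comp i ω n (Φ.coding (fun j => ω (n + j)) i) := by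
  rw [comp_eq, coding, ← (hV.summable_coding i ω).sum_add_tsum_nat_add n, coding, ← tsum_mul_left]
  congr 2
  funext m
  rw [add_comm m n, Finset.prod_range_add, mul_assoc]

theorem Valid.tendsto_comp (hV : Φ.Valid) (i : Fin d) (ω : ℕ → Φ.Symb) :
    Tendsto (fun n => Φ.comp i ω n 0) atTop (𝓝 (Φ.coding ω i)) := by
  simp only [comp_eq, mul_zero, add_zero]
  exact (hV.summable_coding i ω).hasSum.tendsto_sum_nat

theorem Valid.coding_mem_Icc (hV : Φ.Valid) (i : Fin d) (ω : ℕ → Φ.Symb) :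
    Φ.coding ω i ∈ Icc (0 : ℝ) 1 :=
  isClosed_Icc.mem_of_tendsto (hV.tendsto_comp i ω)
    (Eventually.of_forall fun n => hV.comp_mem_Icc i ω n ⟨le_rfl, zero_le_one⟩)

theorem Valid.measurable_coding (hV : Φ.Valid) : Measurable Φ.coding := by
  refine measurable_pi_iff.2 fun i => ?_
  refine measurable_of_tendsto_metrizable (f := fun n ω => Φ.comp i ω n 0) (fun n => ?_)
    (tendsto_pi_nhds.2 fun ω => hV.tendsto_comp i ω)
  have hm : ∀ (f : Φ.Symb → ℝ) (k : ℕ), Measurable fun ω : ℕ → Φ.Symb => f (ω k) :=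
    fun f k => (measurable_from_top (f := f)).comp (measurable_pi_apply k)
  simp only [comp_eq, mul_zero, add_zero]
  refine Finset.measurable_sum _ fun k _ => Measurable.mul ?_ (hm (fun a => Φ.off i (a.1 i)) k)
  exact Finset.measurable_prod _ fun j _ => hm (fun a => Φ.slope i (a.1 i)) j

/-- The first time at which the accumulated contraction in coordinate `i` reaches `n`. -/
noncomputable def cut (Φ : DiagIFS d A) (i : Fin d) (ω : ℕ → Φ.Symb) (n : ℕ) : ℕ :=
  sInf {k | (n : ℝ) ≤ Φ.rateSum i ω k}

/-- The coordinates whose accumulated contraction has not yet reached `n` at time `k`. -/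
noncomputable def active (Φ : DiagIFS d A) (ω : ℕ → Φ.Symb) (n k : ℕ) : Finset (Fin d) :=
  Finset.univ.filter fun i => Φ.rateSum i ω k < n

/-- The sequences agreeing with `ω` at every time `k` in the coordinates `I k`. -/
def agree (Φ : DiagIFS d A) (I : ℕ → Finset (Fin d)) (ω : ℕ → Φ.Symb) : Set (ℕ → Φ.Symb) :=
  {σ | ∀ k, ∀ i ∈ I k, (σ k).1 i = (ω k).1 i}

theorem mem_active {ω : ℕ → Φ.Symb} {n k : ℕ} {i : Fin d} :
    i ∈ Φ.active ω n k ↔ Φ.rateSum i ω k < n := by simp [active]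

theorem Valid.le_rateSum_cut (hV : Φ.Valid) (i : Fin d) (ω : ℕ → Φ.Symb) (n : ℕ) :
    (n : ℝ) ≤ Φ.rateSum i ω (Φ.cut i ω n) := by
  obtain ⟨c, C, h⟩ := hV.exists_rateBound
  have hne : {k | (n : ℝ) ≤ Φ.rateSum i ω k}.Nonempty := by
    obtain ⟨k, hk⟩ := exists_nat_ge ((n : ℝ) / c)
    refine ⟨k, le_trans ?_ (h.mul_le_rateSum i ω k)⟩
    rwa [div_le_iff₀' h.pos] at hk
  exact Nat.sInf_mem hne

theorem Valid.lt_cut_iff (hV : Φ.Valid) {i : Fin d} {ω : ℕ → Φ.Symb} {n k : ℕ} :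
    k < Φ.cut i ω n ↔ Φ.rateSum i ω k < n := by
  constructor
  · intro h
    exact not_le.1 (Nat.notMem_of_lt_sInf h)
  · intro h
    by_contra! hk
    exact absurd ((hV.le_rateSum_cut i ω n).trans (hV.rateSum_mono i ω hk)) (not_le.2 h)

theorem RateBound.active_eq_empty {c C : ℝ} (h : Φ.RateBound c C) (ω : ℕ → Φ.Symb) {n k : ℕ}
    (hk : (n : ℝ) ≤ c * k) : Φ.active ω n k = ∅ := by
  refine Finset.eq_empty_of_forall_notMem fun i hi => ?_
  linarith [mem_active.1 hi, h.mul_le_rateSum i ω k]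

theorem Valid.active_anti (hV : Φ.Valid) (ω : ℕ → Φ.Symb) (n : ℕ) {j k : ℕ} (h : j ≤ k) :
    Φ.active ω n k ⊆ Φ.active ω n j := fun i hi =>
  mem_active.2 ((hV.rateSum_mono i ω h).trans_lt (mem_active.1 hi))

theorem agree_anti {I I' : ℕ → Finset (Fin d)} (h : ∀ k, I k ⊆ I' k) (ω : ℕ → Φ.Symb) :
    Φ.agree I' ω ⊆ Φ.agree I ω := fun _ hσ k i hi => hσ k i (h k hi)

theorem Valid.dist_coding_le (hV : Φ.Valid) {ω σ : ℕ → Φ.Symb} {n : ℕ}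
    (h : σ ∈ Φ.agree (Φ.active ω n) ω) :
    dist (Φ.coding σ) (Φ.coding ω) ≤ Real.exp (-n) := by
  refine (dist_pi_le_iff (Real.exp_pos _).le).2 fun i => ?_
  have hag : ∀ j < Φ.cut i ω n, (σ j).1 i = (ω j).1 i := fun j hj =>
    h j i (mem_active.2 (hV.lt_cut_iff.1 hj))
  rw [hV.coding_eq_comp i σ (Φ.cut i ω n), hV.coding_eq_comp i ω (Φ.cut i ω n), comp_congr hag,
    comp_eq, comp_eq, Real.dist_eq, add_sub_add_left_eq_sub, ← mul_sub, abs_mul,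
    hV.abs_prod_slope]
  have h1 := hV.coding_mem_Icc i fun j => σ (Φ.cut i ω n + j)
  have h2 := hV.coding_mem_Icc i fun j => ω (Φ.cut i ω n + j)
  calc _ ≤ Real.exp (-Φ.rateSum i ω (Φ.cut i ω n)) * 1 := by
        gcongr
        exact abs_le.2 ⟨by linarith [h1.1, h2.2], by linarith [h1.2, h2.1]⟩
    _ ≤ _ := by
      rw [mul_one, Real.exp_le_exp]
      linarith [hV.le_rateSum_cut i ω n]

theorem mem_agree_self (I : ℕ → Finset (Fin d)) (ω : ℕ → Φ.Symb) : ω ∈ Φ.agree I ω :=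
  fun _ _ _ => rfl

/-- The midpoint of the level `n` interval of `ω` in coordinate `i`. -/
noncomputable def mid (Φ : DiagIFS d A) (ω : ℕ → Φ.Symb) (n : ℕ) (i : Fin d) : ℝ :=
  Φ.comp i ω (Φ.cut i ω n) (1 / 2)

theorem Valid.cut_eq_cut (hV : Φ.Valid) {i : Fin d} {ω σ : ℕ → Φ.Symb} {n : ℕ}
    (h : ∀ j < Φ.cut i ω n, (σ j).1 i = (ω j).1 i) : Φ.cut i σ n = Φ.cut i ω n := by
  refine le_antisymm ?_ ?_
  · by_contra! hlt
    have h1 := hV.lt_cut_iff.1 hlt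
    rw [rateSum_congr h] at h1
    exact absurd (hV.le_rateSum_cut i ω n) (not_le.2 h1)
  · by_contra! hlt
    have h1 := hV.lt_cut_iff.1 hlt
    rw [← rateSum_congr fun j hj => h j (hj.trans hlt)] at h1
    exact absurd (hV.le_rateSum_cut i σ n) (not_le.2 h1)

theorem Valid.dist_mid_coding_le (hV : Φ.Valid) (ω : ℕ → Φ.Symb) (n : ℕ) :
    dist (Φ.mid ω n) (Φ.coding ω) ≤ Real.exp (-n) := by
  refine (dist_pi_le_iff (Real.exp_pos _).le).2 fun i => ?_
  rw [hV.coding_eq_comp i ω (Φ.cut i ω n), mid, comp_eq, comp_eq, Real.dist_eq,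
    add_sub_add_left_eq_sub, ← mul_sub, abs_mul, hV.abs_prod_slope]
  have h2 := hV.coding_mem_Icc i fun j => ω (Φ.cut i ω n + j)
  calc _ ≤ Real.exp (-Φ.rateSum i ω (Φ.cut i ω n)) * 1 := by
        gcongr
        exact abs_le.2 ⟨by linarith [h2.2], by linarith [h2.1]⟩
    _ ≤ _ := by
      rw [mul_one, Real.exp_le_exp]
      linarith [hV.le_rateSum_cut i ω n]

theorem RateBound.rateSum_cut_le {c C : ℝ} (h : Φ.RateBound c C) (hV : Φ.Valid) (i : Fin d)
    (ω : ℕ → Φ.Symb) (n : ℕ) : Φ.rateSum i ω (Φ.cut i ω n) ≤ n + C := by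
  rcases Nat.eq_zero_or_pos (Φ.cut i ω n) with h0 | h0
  · rw [h0]; simp only [rateSum, Finset.range_zero, Finset.sum_empty]
    linarith [h.one_le, (Nat.cast_nonneg n : (0 : ℝ) ≤ n)]
  · obtain ⟨m, hm⟩ := Nat.exists_eq_succ_of_ne_zero h0.ne'
    have h1 := hV.lt_cut_iff.1 (show m < Φ.cut i ω n by omega)
    rw [hm, Nat.succ_eq_add_one, rateSum_succ]
    linarith [h.upper i (ω m)]

theorem abs_sub_ge_of_disjoint {m₁ m₂ p₁ p₂ δ : ℝ} (h₁ : δ ≤ |p₁|) (h₂ : δ ≤ |p₂|) (hδ : 0 < δ)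
    (hd : ∀ x₁ ∈ Ioo (0 : ℝ) 1, ∀ x₂ ∈ Ioo (0 : ℝ) 1,
      m₁ + p₁ * (x₁ - 1 / 2) ≠ m₂ + p₂ * (x₂ - 1 / 2)) : δ ≤ |m₁ - m₂| := by
  by_contra! hlt
  have hp₁ : p₁ ≠ 0 := abs_pos.1 (hδ.trans_le h₁)
  have hp₂ : p₂ ≠ 0 := abs_pos.1 (hδ.trans_le h₂)
  have key : ∀ p t : ℝ, p ≠ 0 → δ ≤ |p| → |t| < δ → 1 / 2 + t / 2 / p ∈ Ioo (0 : ℝ) 1 := by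
    intro p t hp hδp ht
    have : |t / 2 / p| < 1 / 2 := by
      rw [abs_div, abs_div, abs_two, div_lt_iff₀ (abs_pos.2 hp)]
      linarith
    rw [abs_lt] at this
    exact ⟨by linarith [this.1], by linarith [this.2]⟩
  refine hd _ (key p₁ (m₂ - m₁) hp₁ h₁ (by rwa [abs_sub_comm])) _ (key p₂ (m₁ - m₂) hp₂ h₂ hlt) ?_
  field_simp
  ring

theorem RateBound.le_dist_mid {c C : ℝ} (h : Φ.RateBound c C) (hV : Φ.Valid) (hB : Φ.Baranski)
    {ω σ : ℕ → Φ.Symb} {n : ℕ} (hσ : σ ∉ Φ.agree (Φ.active ω n) ω) :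
    ∃ i, Real.exp (-C) * Real.exp (-n) ≤ |Φ.mid ω n i - Φ.mid σ n i| := by
  simp only [agree, mem_ofPred_eq, not_forall] at hσ
  obtain ⟨k, i, hki, hne⟩ := hσ
  have hex : ∃ k, k < Φ.cut i ω n ∧ (σ k).1 i ≠ (ω k).1 i :=
    ⟨k, hV.lt_cut_iff.2 (mem_active.1 hki), hne⟩
  obtain ⟨m, ⟨hm1, hm2⟩, hmin⟩ : ∃ m, (m < Φ.cut i ω n ∧ (σ m).1 i ≠ (ω m).1 i) ∧
      ∀ j < m, (σ j).1 i = (ω j).1 i := by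
    refine ⟨Nat.find hex, Nat.find_spec hex, fun j hj => ?_⟩
    by_contra hj2
    exact Nat.find_min hex hj ⟨hj.trans (Nat.find_spec hex).1, hj2⟩
  have hm3 : m < Φ.cut i σ n := by
    rw [hV.lt_cut_iff, rateSum_congr hmin]
    exact hV.lt_cut_iff.1 hm1
  refine ⟨i, ?_⟩
  have hlen : ∀ τ : ℕ → Φ.Symb, Real.exp (-C) * Real.exp (-n) ≤
      |∏ j ∈ Finset.range (Φ.cut i τ n), Φ.slope i ((τ j).1 i)| := by
    intro τ
    rw [hV.abs_prod_slope, ← Real.exp_add, Real.exp_le_exp]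
    linarith [h.rateSum_cut_le hV i τ n]
  have hform : ∀ (τ : ℕ → Φ.Symb) (x : ℝ), Φ.mid τ n i +
      (∏ j ∈ Finset.range (Φ.cut i τ n), Φ.slope i ((τ j).1 i)) * (x - 1 / 2) =
        Φ.comp i τ (Φ.cut i τ n) x := by
    intro τ x
    rw [mid, comp_eq, comp_eq]; ring
  have hsplit : ∀ τ : ℕ → Φ.Symb, m < Φ.cut i τ n → ∀ x ∈ Ioo (0 : ℝ) 1, ∃ y ∈ Ioo (0 : ℝ) 1,
      Φ.comp i τ (Φ.cut i τ n) x = Φ.comp i τ m (Φ.base i ((τ m).1 i) y) := by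
    intro τ hτ x hx
    obtain ⟨e, he⟩ := Nat.exists_eq_add_of_lt hτ
    refine ⟨_, hV.comp_mem_Ioo i (fun j => τ (m + 1 + j)) e hx, ?_⟩
    rw [he, show m + e + 1 = m + 1 + e by ring, comp_add, comp]
  refine abs_sub_ge_of_disjoint (hlen ω) (hlen σ) (by positivity) fun x₁ hx₁ x₂ hx₂ heq => ?_
  rw [hform, hform] at heq
  obtain ⟨y₁, hy₁, e₁⟩ := hsplit ω hm1 x₁ hx₁
  obtain ⟨y₂, hy₂, e₂⟩ := hsplit σ hm3 x₂ hx₂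
  rw [e₁, e₂, comp_congr hmin, comp_eq, comp_eq, add_right_inj] at heq
  have h0 : (∏ j ∈ Finset.range m, Φ.slope i ((ω j).1 i)) ≠ 0 :=
    Finset.prod_ne_zero_iff.2 fun j _ => hV.2.1 _ _
  exact Set.disjoint_left.1 (hB i _ _ hm2) ⟨y₂, hy₂, rfl⟩ ⟨y₁, hy₁, mul_left_cancel₀ h0 heq⟩

theorem Valid.active_eq_of_mem (hV : Φ.Valid) {ω σ : ℕ → Φ.Symb} {n : ℕ}
    (h : σ ∈ Φ.agree (Φ.active ω n) ω) (k : ℕ) : Φ.active σ n k = Φ.active ω n k := by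
  ext i
  have hag : ∀ j < Φ.cut i ω n, (σ j).1 i = (ω j).1 i := fun j hj =>
    h j i (mem_active.2 (hV.lt_cut_iff.1 hj))
  rw [mem_active, mem_active, ← hV.lt_cut_iff, ← hV.lt_cut_iff, hV.cut_eq_cut hag]

end DiagIFS

theorem le_measDim_of_frequent {X : Type*} [MetricSpace X] [SecondCountableTopology X]
    [MeasurableSpace X] [BorelSpace X] [HasBesicovitchCovering X] {ρ ν : Measure X}
    [IsFiniteMeasure ν] (hle : ρ ≤ ν) (h0 : ρ ≠ 0) {K s r₀ : ℝ} (hK : 0 < K) (hr₀ : 0 < r₀)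
    (h : ∀ x, ∀ r ∈ Ioo 0 r₀, ρ (closedBall x r) ≤ ENNReal.ofReal (K * r ^ s)) :
    ENNReal.ofReal s ≤ measDim ν := by
  have : IsFiniteMeasure ρ := isFiniteMeasure_of_le ν hle
  have hac : ρ ≪ ν := Measure.absolutelyContinuous_of_le hle
  have hpos : ν {x | ρ.rnDeriv ν x ≠ 0} ≠ 0 := by
    intro hz
    apply h0
    rw [← Measure.withDensity_rnDeriv_eq ρ ν hac, withDensity_eq_zero_iff (by fun_prop)]
    exact ae_iff.2 hz
  have hpt : ∀ x, Tendsto (fun r => ρ (closedBall x r) / ν (closedBall x r)) (𝓝[>] 0)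
      (𝓝 (ρ.rnDeriv ν x)) → ρ.rnDeriv ν x ≠ 0 → ENNReal.ofReal s ≤ lowerPtDim ν x := by
    intro x hx hx0
    obtain ⟨c, hc0, hc⟩ := ENNReal.lt_iff_exists_nnreal_btwn.1 (pos_iff_ne_zero.2 hx0)
    have hc0' : (0 : ℝ) < c := by exact_mod_cast hc0
    have hev : ∀ᶠ r in 𝓝[>] (0 : ℝ), (c : ℝ≥0∞) < ρ (closedBall x r) / ν (closedBall x r) :=
      hx.eventually (lt_mem_nhds hc)
    obtain ⟨ε, hε, hεs⟩ := mem_nhdsGT_iff_exists_Ioo_subset.1 hev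
    have hε0 : (0 : ℝ) < ε := hε
    have hlim : Tendsto (fun r : ℝ => ENNReal.ofReal (s + Real.log (K / c) / Real.log r)) (𝓝[>] 0)
        (𝓝 (ENNReal.ofReal s)) := by
      have : Tendsto (fun r : ℝ => s + Real.log (K / c) / Real.log r) (𝓝[>] 0) (𝓝 (s + 0)) :=
        tendsto_const_nhds.add (Real.tendsto_log_nhdsGT_zero.const_div_atBot _)
      rw [add_zero] at this
      exact ENNReal.tendsto_ofReal this
    rw [← hlim.liminf_eq]
    refine liminf_le_liminf ?_
    filter_upwards [Ioo_mem_nhdsGT (lt_min (lt_min hε0 hr₀) one_pos)] with r hr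
    have hr0 := hr.1
    have hrε : r < ε := hr.2.trans_le ((min_le_left _ _).trans (min_le_left _ _))
    have hrr₀ : r < r₀ := hr.2.trans_le ((min_le_left _ _).trans (min_le_right _ _))
    have hr1 : r < 1 := hr.2.trans_le (min_le_right _ _)
    have hlog : Real.log r < 0 := Real.log_neg hr0 hr1
    have hball : 0 < ν (ball x r) := by
      have h1 : (c : ℝ≥0∞) < _ := hεs ⟨half_pos hr0, by linarith⟩
      have h2 : ρ (closedBall x (r / 2)) ≠ 0 := by
        intro hz; rw [hz, ENNReal.zero_div] at h1; exact absurd h1 (not_lt.2 (zero_le))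
      calc 0 < ρ (closedBall x (r / 2)) := pos_iff_ne_zero.2 h2
        _ ≤ ν (closedBall x (r / 2)) := hle _
        _ ≤ ν (ball x r) := measure_mono (closedBall_subset_ball (by linarith))
    have hcb : ν (ball x r) ≤ ENNReal.ofReal (K / c * r ^ s) := by
      have h1 : (c : ℝ≥0∞) < ρ (closedBall x r) / ν (closedBall x r) := hεs ⟨hr0, hrε⟩
      have h2 := (ENNReal.mul_le_of_le_div h1.le).trans (h x r ⟨hr0, hrr₀⟩)
      calc ν (ball x r) ≤ ν (closedBall x r) := measure_mono ball_subset_closedBall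
        _ ≤ ENNReal.ofReal (K * r ^ s) / c := by
          rw [ENNReal.le_div_iff_mul_le (Or.inl hc0.ne') (Or.inl ENNReal.coe_ne_top), mul_comm]
          exact h2
        _ = _ := by
          rw [← ENNReal.ofReal_coe_nnreal, ← ENNReal.ofReal_div_of_pos hc0']
          congr 1; ring
    refine ENNReal.ofReal_le_ofReal ?_
    have hb0 : 0 < (ν (ball x r)).toReal :=
      ENNReal.toReal_pos hball.ne' (measure_ne_top _ _)
    have hb1 : (ν (ball x r)).toReal ≤ K / c * r ^ s :=
      ENNReal.toReal_le_of_le_ofReal (by positivity) hcb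
    have hl : Real.log (ν (ball x r)).toReal ≤ Real.log (K / c) + s * Real.log r := by
      rw [← Real.log_rpow hr0, ← Real.log_mul (by positivity) (by positivity)]
      exact Real.log_le_log hb0 hb1
    rw [le_div_iff_of_neg hlog, add_mul, div_mul_cancel₀ _ hlog.ne]
    linarith
  by_contra! hlt
  have hae := ae_lt_of_essSup_lt (f := lowerPtDim ν) (μ := ν) hlt
  refine hpos (measure_mono_null ?_ (ae_iff.1 (hae.and (Besicovitch.ae_tendsto_rnDeriv ρ ν))))
  intro x hx hx2
  exact absurd (hpt x hx2.2 hx) (not_le.2 hx2.1)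

namespace DiagIFS
variable {Φ : DiagIFS d A}

theorem RateBound.measure_inter_closedBall_le {c C : ℝ} (h : Φ.RateBound c C) (hV : Φ.Valid)
    (hB : Φ.Baranski) (μ : Measure (ℕ → Φ.Symb)) {X : Set (ℕ → Φ.Symb)} {n : ℕ} {m : ℝ≥0∞}
    (hX : ∀ ω ∈ X, μ (Φ.agree (Φ.active ω n) ω) ≤ m) (x : Fin d → ℝ) :
    μ (Φ.coding ⁻¹' closedBall x (Real.exp (-n)) ∩ X) ≤
      ENNReal.ofReal ((4 * Real.exp C + 2) ^ d) * m := by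
  set δ : ℝ := Real.exp (-C) * Real.exp (-n) with hδ
  have hδ0 : 0 < δ := by positivity
  have hexp : Real.exp (-n) / δ = Real.exp C := by
    rw [hδ, Real.exp_neg C]
    field_simp
  set T := Φ.coding ⁻¹' closedBall x (Real.exp (-n)) ∩ X with hT
  let g : (ℕ → Φ.Symb) → Fin d → ℤ := fun ω i => ⌊Φ.mid ω n i / δ⌋
  let J : Fin d → Finset ℤ := fun i =>
    Finset.Icc ⌊x i / δ - 2 * Real.exp C⌋ ⌊x i / δ + 2 * Real.exp C⌋
  let Box : Finset (Fin d → ℤ) := Fintype.piFinset J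
  have hcard : ((Box.card : ℕ) : ℝ) ≤ (4 * Real.exp C + 2) ^ d := by
    rw [Fintype.card_piFinset, Nat.cast_prod]
    calc ∏ i, ((J i).card : ℝ) ≤ ∏ _i : Fin d, (4 * Real.exp C + 2) := by
          refine Finset.prod_le_prod (fun _ _ => Nat.cast_nonneg _) fun i _ => ?_
          have hle : ⌊x i / δ - 2 * Real.exp C⌋ ≤ ⌊x i / δ + 2 * Real.exp C⌋ + 1 := by
            have := Int.floor_le_floor (show x i / δ - 2 * Real.exp C ≤ x i / δ + 2 * Real.exp C by
              linarith [Real.exp_pos C])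
            linarith
          have : ((J i).card : ℝ) = ((((J i).card : ℕ) : ℤ) : ℝ) := by norm_cast
          rw [this, Int.card_Icc_of_le _ _ hle]
          push_cast
          linarith [Int.floor_le (x i / δ + 2 * Real.exp C),
            Int.lt_floor_add_one (x i / δ - 2 * Real.exp C)]
      _ = _ := by simp
  have hmem : ∀ ω ∈ T, g ω ∈ Box := by
    intro ω hω
    refine Fintype.mem_piFinset.2 fun i => ?_
    have h1 : dist (Φ.mid ω n) x ≤ 2 * Real.exp (-n) := by
      have h2 : dist (Φ.coding ω) x ≤ Real.exp (-n) := hω.1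
      linarith [dist_triangle (Φ.mid ω n) (Φ.coding ω) x, hV.dist_mid_coding_le ω n]
    have h2 := (dist_le_pi_dist (Φ.mid ω n) x i).trans h1
    rw [Real.dist_eq, abs_le] at h2
    have h3 : 2 * Real.exp (-n) / δ = 2 * Real.exp C := by rw [mul_div_assoc, hexp]
    rw [Finset.mem_Icc]
    constructor <;> apply Int.floor_le_floor <;> rw [← h3, ← sub_nonneg]
    · have : Φ.mid ω n i / δ - (x i / δ - 2 * Real.exp (-n) / δ) =
        (Φ.mid ω n i - x i + 2 * Real.exp (-n)) / δ := by ring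
      rw [this]; exact div_nonneg (by linarith [h2.1]) hδ0.le
    · have : x i / δ + 2 * Real.exp (-n) / δ - Φ.mid ω n i / δ =
        (2 * Real.exp (-n) - (Φ.mid ω n i - x i)) / δ := by ring
      rw [this]; exact div_nonneg (by linarith [h2.2]) hδ0.le
  have hcover : T ⊆ ⋃ v ∈ Box, T ∩ g ⁻¹' {v} := fun ω hω =>
    mem_iUnion₂.2 ⟨g ω, hmem ω hω, hω, rfl⟩
  have hpiece : ∀ v, μ (T ∩ g ⁻¹' {v}) ≤ m := by
    intro v
    rcases (T ∩ g ⁻¹' {v}).eq_empty_or_nonempty with he | ⟨ω, hωT, hωv⟩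
    · simp [he]
    refine (measure_mono fun σ hσ => ?_).trans (hX ω hωT.2)
    by_contra hnot
    obtain ⟨i, hi⟩ := h.le_dist_mid hV hB hnot
    have hg : ⌊Φ.mid ω n i / δ⌋ = ⌊Φ.mid σ n i / δ⌋ := by
      have h1 : g ω = v := hωv
      have h2 : g σ = v := hσ.2
      exact congrFun (h1.trans h2.symm) i
    have := Int.abs_sub_lt_one_of_floor_eq_floor hg
    rw [← sub_div, abs_div, abs_of_pos hδ0, div_lt_one hδ0] at this
    exact absurd hi (not_le.2 this)
  calc μ T ≤ ∑ v ∈ Box, μ (T ∩ g ⁻¹' {v}) :=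
        (measure_mono hcover).trans (measure_biUnion_finset_le _ _)
    _ ≤ ∑ _v ∈ Box, m := Finset.sum_le_sum fun v _ => hpiece v
    _ = ENNReal.ofReal (Box.card : ℝ) * m := by
      rw [Finset.sum_const, nsmul_eq_mul, ENNReal.ofReal_natCast]
    _ ≤ _ := by gcongr

theorem Valid.le_measDim_map_coding (hV : Φ.Valid) (hB : Φ.Baranski) (μ : Measure (ℕ → Φ.Symb))
    [IsFiniteMeasure μ] {X : Set (ℕ → Φ.Symb)} (hX0 : μ X ≠ 0) {s : ℝ}
    (hs : 0 ≤ s) {N : ℕ}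
    (hX : ∀ ω ∈ X, ∀ n ≥ N, μ (Φ.agree (Φ.active ω n) ω) ≤ ENNReal.ofReal (Real.exp (-(s * n)))) :
    ENNReal.ofReal s ≤ measDim (μ.map Φ.coding) := by
  obtain ⟨c, C, h⟩ := hV.exists_rateBound
  have hm := hV.measurable_coding
  have := Measure.isFiniteMeasure_map μ Φ.coding
  refine le_measDim_of_frequent (ρ := (μ.restrict X).map Φ.coding)
    (Measure.map_mono Measure.restrict_le_self hm) ?_
    (K := (4 * Real.exp C + 2) ^ d * Real.exp s) (r₀ := Real.exp (-N)) (by positivity)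
    (Real.exp_pos _) fun x r hr => ?_
  · rw [Ne, Measure.map_eq_zero_iff hm.aemeasurable, Measure.restrict_eq_zero]
    exact hX0
  · set n := ⌊-Real.log r⌋₊ with hn
    have hlog : (N : ℝ) < -Real.log r := by
      have := Real.log_lt_log hr.1 hr.2
      rw [Real.log_exp] at this
      linarith
    have hN0 : (0 : ℝ) ≤ N := Nat.cast_nonneg _
    have hnN : N ≤ n := Nat.le_floor hlog.le
    have h1 : (n : ℝ) ≤ -Real.log r := Nat.floor_le (by linarith)
    have h2 : -Real.log r < n + 1 := Nat.lt_floor_add_one _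
    have hrn : r ≤ Real.exp (-n) := by
      rw [← Real.exp_log hr.1, Real.exp_le_exp]
      linarith
    rw [Measure.map_apply hm measurableSet_closedBall,
      Measure.restrict_apply (hm measurableSet_closedBall)]
    calc μ (Φ.coding ⁻¹' closedBall x r ∩ X)
        ≤ μ (Φ.coding ⁻¹' closedBall x (Real.exp (-n)) ∩ X) :=
          measure_mono (inter_subset_inter_left _ (preimage_mono (closedBall_subset_closedBall hrn)))
      _ ≤ ENNReal.ofReal ((4 * Real.exp C + 2) ^ d) * ENNReal.ofReal (Real.exp (-(s * n))) :=
          h.measure_inter_closedBall_le hV hB μ (fun ω hω => hX ω hω n hnN) x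
      _ ≤ _ := by
        rw [← ENNReal.ofReal_mul (by positivity)]
        refine ENNReal.ofReal_le_ofReal ?_
        rw [mul_assoc]
        gcongr
        rw [Real.rpow_def_of_pos hr.1, ← Real.exp_add, Real.exp_le_exp]
        nlinarith

end DiagIFS

namespace DiagIFS

variable {Φ : DiagIFS d A}

instance (Φ : DiagIFS d A) : DiscreteMeasurableSpace Φ.Symb := ⟨fun _ => trivial⟩

/-- The probability vectors on the alphabet. -/
abbrev ProbVec (Φ : DiagIFS d A) : Type := {p : Φ.Symb → ℝ // IsProbVec p}

/-- The measure on the alphabet with density `p`. -/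
noncomputable def vecMeas (p : Φ.ProbVec) : Measure Φ.Symb :=
  ∑ a, ENNReal.ofReal (p.1 a) • Measure.dirac a

theorem vecMeas_apply (p : Φ.ProbVec) (S : Set Φ.Symb) :
    vecMeas p S = ENNReal.ofReal (∑ a, if a ∈ S then p.1 a else 0) := by
  rw [ENNReal.ofReal_sum_of_nonneg fun a _ => by split_ifs; exacts [p.2.1 a, le_rfl]]
  simp only [vecMeas, Measure.finsetSum_apply, Measure.smul_apply, smul_eq_mul]
  refine Finset.sum_congr rfl fun a _ => ?_
  by_cases h : a ∈ S <;> simp [h]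

instance (p : Φ.ProbVec) : IsProbabilityMeasure (vecMeas p) :=
  ⟨by rw [vecMeas_apply]; simp [p.2.2, -Finset.univ_eq_attach]⟩

theorem integral_vecMeas (p : Φ.ProbVec) (f : Φ.Symb → ℝ) :
    ∫ a, f a ∂vecMeas p = ∑ a, p.1 a * f a := by
  rw [integral_fintype (Integrable.of_finite)]
  refine Finset.sum_congr rfl fun a _ => ?_
  rw [measureReal_def, vecMeas_apply]
  simp [p.2.1 a]

/-- The product measure with factors `p k`. -/
noncomputable def pathMeas (p : ℕ → Φ.ProbVec) : Measure (ℕ → Φ.Symb) :=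
  Measure.infinitePi fun k => vecMeas (p k)

instance (p : ℕ → Φ.ProbVec) : IsProbabilityMeasure (pathMeas p) := by
  unfold pathMeas; infer_instance

theorem pathMeas_pi (p : ℕ → Φ.ProbVec) (s : Finset ℕ) (S : ℕ → Set Φ.Symb) :
    (pathMeas p).real {σ | ∀ k ∈ s, σ k ∈ S k} =
      ∏ k ∈ s, ∑ a, if a ∈ S k then (p k).1 a else 0 := by
  have h : {σ : ℕ → Φ.Symb | ∀ k ∈ s, σ k ∈ S k} = Set.pi s S := rfl
  rw [measureReal_def, h, pathMeas, Measure.infinitePi_pi _ fun _ _ => MeasurableSet.of_discrete,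
    ENNReal.toReal_prod]
  refine Finset.prod_congr rfl fun k _ => ?_
  rw [vecMeas_apply, ENNReal.toReal_ofReal]
  exact Finset.sum_nonneg fun a _ => by split_ifs; exacts [(p k).2.1 a, le_rfl]

theorem isProductMeasure_pathMeas (p : ℕ → Φ.ProbVec) :
    IsProductMeasure Φ (fun k => (p k).1) (pathMeas p) := by
  refine ⟨inferInstance, fun n w => ?_⟩
  have := pathMeas_pi p (Finset.range n) fun k => {w k}
  simpa [measureReal_def] using this

theorem pathMeas_cylinder (p : ℕ → Φ.ProbVec) (I : ℕ → Finset (Fin d)) (ω : ℕ → Φ.Symb)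
    (s : Finset ℕ) :
    (pathMeas p).real {σ | ∀ k ∈ s, ∀ i ∈ I k, (σ k).1 i = (ω k).1 i} =
      ∏ k ∈ s, Φ.cylMass (I k) (p k).1 (ω k) := by
  refine (pathMeas_pi p s fun k => {b | ∀ i ∈ I k, b.1 i = (ω k).1 i}).trans ?_
  refine Finset.prod_congr rfl fun k _ => Finset.sum_congr rfl fun b _ => ?_
  by_cases h : ∀ i ∈ I k, b.1 i = (ω k).1 i
  · rw [if_pos h]; exact if_pos h
  · rw [if_neg h]; exact if_neg h

theorem pathMeas_agree_le (p : ℕ → Φ.ProbVec) (I : ℕ → Finset (Fin d)) (ω : ℕ → Φ.Symb)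
    (s : Finset ℕ) :
    (pathMeas p).real (Φ.agree I ω) ≤ ∏ k ∈ s, Φ.cylMass (I k) (p k).1 (ω k) := by
  rw [← pathMeas_cylinder]
  refine measureReal_mono ?_ (measure_ne_top _ _)
  exact fun σ hσ k _ => hσ k

theorem pathMeas_agree (p : ℕ → Φ.ProbVec) {I : ℕ → Finset (Fin d)} (ω : ℕ → Φ.Symb)
    {N : ℕ} (hI : ∀ k, N ≤ k → I k = ∅) :
    (pathMeas p).real (Φ.agree I ω) =
      ∏ k ∈ Finset.range N, Φ.cylMass (I k) (p k).1 (ω k) := by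
  rw [← pathMeas_cylinder]
  congr 1
  ext σ
  refine ⟨fun hσ k _ => hσ k, fun hσ k => ?_⟩
  by_cases hk : k < N
  · exact hσ k (Finset.mem_range.2 hk)
  · simp [hI k (not_lt.1 hk)]

theorem cylMass_anti {p : Φ.Symb → ℝ} (hp : IsProbVec p) {I J : Finset (Fin d)} (h : I ⊆ J)
    (a : Φ.Symb) : Φ.cylMass J p a ≤ Φ.cylMass I p a := by
  refine Finset.sum_le_sum fun b _ => ?_
  by_cases hJ : ∀ i ∈ J, b.1 i = a.1 i
  · rw [if_pos hJ, if_pos fun i hi => hJ i (h hi)]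
  · rw [if_neg hJ]; split_ifs; exacts [hp.1 b, le_rfl]

theorem le_cylMass {p : Φ.Symb → ℝ} (hp : IsProbVec p) (I : Finset (Fin d)) (a : Φ.Symb) :
    p a ≤ Φ.cylMass I p a := by
  have := Finset.single_le_sum (f := fun b : Φ.Symb => if ∀ i ∈ I, b.1 i = a.1 i then p b else 0)
    (fun b _ => by split_ifs; exacts [hp.1 b, le_rfl]) (Finset.mem_univ a)
  simpa [cylMass] using this

@[simp]
theorem cylMass_empty {p : Φ.Symb → ℝ} (hp : IsProbVec p) (a : Φ.Symb) :
    Φ.cylMass ∅ p a = 1 := by simp [cylMass, hp.2, -Finset.univ_eq_attach]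

theorem cylMass_le_one {p : Φ.Symb → ℝ} (hp : IsProbVec p) (I : Finset (Fin d)) (a : Φ.Symb) :
    Φ.cylMass I p a ≤ 1 :=
  (cylMass_anti hp I.empty_subset a).trans_eq (cylMass_empty hp a)

theorem cylMass_nonneg {p : Φ.Symb → ℝ} (hp : IsProbVec p) (I : Finset (Fin d)) (a : Φ.Symb) :
    0 ≤ Φ.cylMass I p a := (hp.1 a).trans (le_cylMass hp I a)

/-- The information `-log p([a]_I)` of a symbol. -/
noncomputable def info (Φ : DiagIFS d A) (I : Finset (Fin d)) (p : Φ.Symb → ℝ) (a : Φ.Symb) : ℝ :=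
  -Real.log (Φ.cylMass I p a)

theorem entropy_eq_sum_info (I : Finset (Fin d)) (p : Φ.Symb → ℝ) :
    Φ.entropy I p = ∑ a, p a * Φ.info I p a := by
  simp [entropy, info]

theorem info_nonneg {p : Φ.Symb → ℝ} (hp : IsProbVec p) (I : Finset (Fin d)) (a : Φ.Symb) :
    0 ≤ Φ.info I p a :=
  neg_nonneg.2 (Real.log_nonpos (cylMass_nonneg hp I a) (cylMass_le_one hp I a))

theorem entropy_nonneg {p : Φ.Symb → ℝ} (hp : IsProbVec p) (I : Finset (Fin d)) :
    0 ≤ Φ.entropy I p := by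
  rw [entropy_eq_sum_info]
  exact Finset.sum_nonneg fun a _ => mul_nonneg (hp.1 a) (info_nonneg hp I a)

@[simp]
theorem entropy_empty {p : Φ.Symb → ℝ} (hp : IsProbVec p) : Φ.entropy ∅ p = 0 := by
  simp [entropy, cylMass_empty hp]

theorem chi_eq_sum_rate (i : Fin d) (p : Φ.Symb → ℝ) : Φ.chi i p = ∑ a, p a * Φ.rate i a := by
  simp [chi, rate]

theorem entropy_eq_sum_negMulLog (I : Finset (Fin d)) (p : Φ.Symb → ℝ) :
    Φ.entropy I p = ∑ x : Set Φ.Symb, Real.negMulLog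
      (∑ a with {b : Φ.Symb | ∀ i ∈ I, b.1 i = a.1 i} = x, p a) := by
  rw [entropy, ← Finset.sum_fiberwise (s := Finset.univ)
    (g := fun a : Φ.Symb => {b : Φ.Symb | ∀ i ∈ I, b.1 i = a.1 i}), ← Finset.sum_neg_distrib]
  refine Finset.sum_congr rfl fun x _ => ?_
  rw [Real.negMulLog, neg_mul, Finset.sum_mul]
  congr 1
  refine Finset.sum_congr rfl fun a ha => ?_
  congr 2
  rw [cylMass, ← Finset.sum_filter]
  congr 1
  ext b
  simp only [Finset.mem_filter, Finset.mem_univ, true_and] at ha ⊢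
  rw [← ha, Set.ext_iff]
  refine ⟨fun h c => ?_, fun h => (h b).1 fun i _ => rfl⟩
  simp only [mem_ofPred_eq]
  exact forall₂_congr fun i hi => by rw [h i hi]

theorem continuous_entropy (I : Finset (Fin d)) : Continuous (Φ.entropy I) := by
  have : Φ.entropy I = fun p => _ := funext (entropy_eq_sum_negMulLog I)
  rw [this]
  refine continuous_finsetSum _ fun x _ => Real.continuous_negMulLog.comp ?_
  exact continuous_finsetSum _ fun a _ => continuous_apply a

theorem continuous_chi (i : Fin d) : Continuous (Φ.chi i) := by
  have : Φ.chi i = fun p => _ := funext (chi_eq_sum_rate i)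
  rw [this]
  exact continuous_finsetSum _ fun a _ => (continuous_apply a).mul continuous_const

theorem _root_.SelfAffineSponge.IsProbVec.le_one {α : Type*} [Fintype α] {p : α → ℝ}
    (hp : IsProbVec p) (a : α) : p a ≤ 1 :=
  (Finset.single_le_sum (fun b _ => hp.1 b) (Finset.mem_univ a)).trans_eq hp.2

theorem _root_.SelfAffineSponge.IsProbVec.mem_Icc {α : Type*} [Fintype α] {p : α → ℝ}
    (hp : IsProbVec p) : p ∈ Icc (0 : α → ℝ) 1 :=
  ⟨fun a => hp.1 a, fun a => hp.le_one a⟩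

theorem exists_entropy_le (Φ : DiagIFS d A) :
    ∃ H : ℝ, 1 ≤ H ∧ ∀ (I : Finset (Fin d)) (p : Φ.Symb → ℝ), IsProbVec p → Φ.entropy I p ≤ H := by
  have h : ∀ I : Finset (Fin d), ∃ H : ℝ, ∀ p : Φ.Symb → ℝ, IsProbVec p → Φ.entropy I p ≤ H := by
    intro I
    obtain ⟨H, hH⟩ := (isCompact_Icc (a := (0 : Φ.Symb → ℝ)) (b := 1)).bddAbove_image
      (continuous_entropy I).continuousOn
    exact ⟨H, fun p hp => hH ⟨p, hp.mem_Icc, rfl⟩⟩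
  choose H hH using h
  obtain ⟨B, hB⟩ := (Set.finite_range H).bddAbove
  exact ⟨max B 1, le_max_right _ _, fun I p hp =>
    (hH I p hp).trans ((hB ⟨I, rfl⟩).trans (le_max_left _ _))⟩

theorem exists_modulus_of_continuous {ι α : Type*} [Finite ι] [Fintype α]
    {f : ι → (α → ℝ) → ℝ} (hf : ∀ j, Continuous (f j)) {ε : ℝ} (hε : 0 < ε) :
    ∃ η > 0, ∀ (j : ι) (p q : α → ℝ), IsProbVec p → IsProbVec q → (∀ a, |p a - q a| ≤ η) →
      |f j p - f j q| ≤ ε := by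
  have h : ∀ j, ∃ η > 0, ∀ p q : α → ℝ, IsProbVec p → IsProbVec q → (∀ a, |p a - q a| ≤ η) →
      |f j p - f j q| ≤ ε := by
    intro j
    have huc := (isCompact_Icc (a := (0 : α → ℝ)) (b := 1)).uniformContinuousOn_of_continuous
      (hf j).continuousOn
    obtain ⟨δ, hδ, hδ'⟩ := Metric.uniformContinuousOn_iff_le.1 huc ε hε
    refine ⟨δ, hδ, fun p q hp hq hpq => hδ' p hp.mem_Icc q hq.mem_Icc ?_⟩
    exact (dist_pi_le_iff hδ.le).2 hpq
  choose η hη h using h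
  cases nonempty_fintype ι
  have : ∀ s : Finset ι, ∃ η₀ > 0, ∀ j ∈ s, η₀ ≤ η j := by
    intro s
    induction s using Finset.induction_on with
    | empty => exact ⟨1, one_pos, by simp⟩
    | insert j s _ ih =>
      obtain ⟨e, he, h'⟩ := ih
      refine ⟨min e (η j), lt_min he (hη j), fun k hk => ?_⟩
      rcases Finset.mem_insert.1 hk with rfl | hk
      exacts [min_le_right _ _, (min_le_left _ _).trans (h' k hk)]
  obtain ⟨η₀, h0, hle⟩ := this Finset.univ
  exact ⟨η₀, h0, fun j p q hp hq hpq =>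
    h j p q hp hq fun a => (hpq a).trans (hle j (Finset.mem_univ j))⟩

theorem RateBound.chi_nonneg {c C : ℝ} (h : Φ.RateBound c C) (i : Fin d) {p : Φ.Symb → ℝ}
    (hp : IsProbVec p) : 0 ≤ Φ.chi i p := by
  rw [chi_eq_sum_rate]
  exact Finset.sum_nonneg fun a _ => mul_nonneg (hp.1 a) (h.pos.le.trans (h.lower i a))

theorem RateBound.chi_le {c C : ℝ} (h : Φ.RateBound c C) (i : Fin d) {p : Φ.Symb → ℝ}
    (hp : IsProbVec p) : Φ.chi i p ≤ C := by
  rw [chi_eq_sum_rate]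
  calc _ ≤ ∑ a, p a * C := Finset.sum_le_sum fun a _ =>
        mul_le_mul_of_nonneg_left (h.upper i a) (hp.1 a)
    _ = C := by rw [← Finset.sum_mul, hp.2, one_mul]

end DiagIFS

/-- The length of the block containing the time `k`: times in `[L^l, L^(l+1))` are grouped into
blocks of length `L^(l-1)`. -/
def blockLen (L k : ℕ) : ℕ := L ^ (Nat.log L k - 1)

/-- The first time of the block containing the time `k`. -/
def blockStart (L k : ℕ) : ℕ := blockLen L k * (k / blockLen L k)

theorem blockLen_pos {L : ℕ} (hL : 2 ≤ L) (k : ℕ) : 0 < blockLen L k := by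
  unfold blockLen; positivity

theorem blockStart_le (L k : ℕ) : blockStart L k ≤ k := Nat.mul_div_le _ _

theorem lt_blockStart_add {L : ℕ} (hL : 2 ≤ L) (k : ℕ) : k < blockStart L k + blockLen L k := by
  have := Nat.lt_mul_div_succ k (blockLen_pos hL k)
  rwa [mul_add, mul_one] at this

theorem log_eq_of_mem_block {L : ℕ} (hL : 2 ≤ L) {k j : ℕ} (h₁ : blockStart L k ≤ j)
    (h₂ : j < blockStart L k + blockLen L k) : Nat.log L j = Nat.log L k := by
  rcases Nat.eq_zero_or_pos (Nat.log L k) with h0 | h0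
  · have : blockLen L k = 1 := by simp [blockLen, h0]
    have : j = k := by
      simp only [blockStart, this, Nat.div_one, one_mul] at h₁ h₂; omega
    rw [this]
  · have hk : k ≠ 0 := by rintro rfl; simp at h0
    obtain ⟨l, hl⟩ := Nat.exists_eq_succ_of_ne_zero h0.ne'
    have hb : blockLen L k = L ^ l := by simp [blockLen, hl]
    have hlo : L ^ (l + 1) ≤ k := by rw [← Nat.succ_eq_add_one, ← hl]; exact Nat.pow_log_le_self L hk
    have hhi : k < L ^ (l + 2) := by
      have := Nat.lt_pow_succ_log_self (show 1 < L by omega) k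
      rwa [hl] at this
    have hpos : 0 < L ^ l := by positivity
    have h3 : L ≤ k / L ^ l := by
      rw [Nat.le_div_iff_mul_le hpos]; rw [pow_succ] at hlo; linarith
    have h4 : k / L ^ l < L ^ 2 := by
      rw [Nat.div_lt_iff_lt_mul hpos, ← pow_add, add_comm]; exact hhi
    rw [blockStart, hb] at h₁ h₂
    rw [hl, Nat.log_eq_iff (Or.inl (Nat.succ_ne_zero l))]
    constructor
    · calc L ^ (l + 1) = L ^ l * L := pow_succ _ _
        _ ≤ L ^ l * (k / L ^ l) := Nat.mul_le_mul_left _ h3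
        _ ≤ j := h₁
    · calc j < L ^ l * (k / L ^ l) + L ^ l := h₂
        _ = L ^ l * (k / L ^ l + 1) := by ring
        _ ≤ L ^ l * L ^ 2 := Nat.mul_le_mul_left _ h4
        _ = L ^ (l + 1 + 1) := by ring

theorem blockLen_eq_of_mem_block {L : ℕ} (hL : 2 ≤ L) {k j : ℕ} (h₁ : blockStart L k ≤ j)
    (h₂ : j < blockStart L k + blockLen L k) : blockLen L j = blockLen L k := by
  rw [blockLen, blockLen, log_eq_of_mem_block hL h₁ h₂]

theorem div_blockLen_eq_of_mem_block {L : ℕ} (hL : 2 ≤ L) {k j : ℕ} (h₁ : blockStart L k ≤ j)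
    (h₂ : j < blockStart L k + blockLen L k) : j / blockLen L j = k / blockLen L k := by
  rw [blockLen_eq_of_mem_block hL h₁ h₂]
  refine Nat.div_eq_of_lt_le ?_ ?_
  · rw [mul_comm]; exact h₁
  · rw [Nat.succ_mul, mul_comm]; exact h₂

theorem blockStart_eq_of_mem_block {L : ℕ} (hL : 2 ≤ L) {k j : ℕ} (h₁ : blockStart L k ≤ j)
    (h₂ : j < blockStart L k + blockLen L k) : blockStart L j = blockStart L k := by
  rw [blockStart, div_blockLen_eq_of_mem_block hL h₁ h₂, blockLen_eq_of_mem_block hL h₁ h₂]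
  rfl

theorem blockStart_blockStart {L : ℕ} (hL : 2 ≤ L) (k : ℕ) :
    blockStart L (blockStart L k) = blockStart L k :=
  blockStart_eq_of_mem_block hL le_rfl (by have := blockLen_pos hL k; omega)

theorem blockStart_pow {L : ℕ} (hL : 2 ≤ L) (J : ℕ) : blockStart L (L ^ J) = L ^ J := by
  rw [blockStart, blockLen, Nat.log_pow (by omega)]
  exact Nat.mul_div_cancel' (pow_dvd_pow L (Nat.sub_le J 1))

theorem block_subset_of_lt {L : ℕ} (hL : 2 ≤ L) {N k : ℕ} (hN : blockStart L N = N) (hk : k < N) :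
    blockStart L k + blockLen L k ≤ N := by
  by_contra! h
  have := blockStart_eq_of_mem_block hL ((blockStart_le L k).trans hk.le) h
  have := blockStart_le L k
  omega

theorem le_two_mul_blockStart {L : ℕ} (hL : 2 ≤ L) (k : ℕ) : k ≤ 2 * blockStart L k := by
  rcases Nat.eq_zero_or_pos k with rfl | hk
  · exact Nat.zero_le _
  have h1 := lt_blockStart_add hL k
  have h2 : blockLen L k ≤ k :=
    (Nat.pow_le_pow_right (by omega) (Nat.sub_le _ 1)).trans (Nat.pow_log_le_self L hk.ne')
  have h3 : 1 ≤ k / blockLen L k := (Nat.one_le_div_iff (blockLen_pos hL k)).2 h2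
  have h4 : blockLen L k ≤ blockStart L k := Nat.le_mul_of_pos_right _ h3
  omega

namespace DiagIFS

variable {Φ : DiagIFS d A}

/-- The number of occurrences of the symbol `e` in the `a`-th word of length `w` of `ω`. -/
noncomputable def wordCount (ω : ℕ → Φ.Symb) (w a : ℕ) (e : Φ.Symb) : ℕ :=
  ((Finset.range w).filter fun u => ω (w * a + u) = e).card

/-- The symbol frequencies in the `a`-th word of length `w` of `ω`. -/
noncomputable def wordFreq (ω : ℕ → Φ.Symb) (w a : ℕ) (e : Φ.Symb) : ℝ :=
  wordCount ω w a e / w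

theorem isProbVec_wordFreq (ω : ℕ → Φ.Symb) {w : ℕ} (hw : 0 < w) (a : ℕ) :
    IsProbVec (wordFreq ω w a) := by
  refine ⟨fun e => by unfold wordFreq; positivity, ?_⟩
  have h := Finset.card_eq_sum_card_fiberwise (f := fun u => ω (w * a + u))
    (s := Finset.range w) (t := Finset.univ) fun _ _ => by simp
  rw [Finset.card_range] at h
  simp only [wordFreq, wordCount, ← Finset.sum_div]
  rw [div_eq_one_iff_eq (by positivity)]
  exact_mod_cast h.symm

/-- The symbol frequencies in the block containing the time `k`. -/
noncomputable def blockFreq (L : ℕ) (ω : ℕ → Φ.Symb) (k : ℕ) : Φ.Symb → ℝ :=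
  wordFreq ω (blockLen L k) (k / blockLen L k)

theorem isProbVec_blockFreq {L : ℕ} (hL : 2 ≤ L) (ω : ℕ → Φ.Symb) (k : ℕ) :
    IsProbVec (blockFreq L ω k) := isProbVec_wordFreq ω (blockLen_pos hL k) _

theorem blockFreq_eq_of_mem_block {L : ℕ} (hL : 2 ≤ L) {k j : ℕ} (h₁ : blockStart L k ≤ j)
    (h₂ : j < blockStart L k + blockLen L k) (ω : ℕ → Φ.Symb) :
    blockFreq L ω j = blockFreq L ω k := by
  rw [blockFreq, div_blockLen_eq_of_mem_block hL h₁ h₂, blockLen_eq_of_mem_block hL h₁ h₂]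
  rfl

theorem blockFreq_pos {L : ℕ} (hL : 2 ≤ L) (ω : ℕ → Φ.Symb) (k : ℕ) :
    0 < blockFreq L ω k (ω k) := by
  have hpos := blockLen_pos hL k
  unfold blockFreq wordFreq
  refine div_pos (Nat.cast_pos.2 (Finset.card_pos.2 ⟨k % blockLen L k, ?_⟩)) (by exact_mod_cast hpos)
  simp [Nat.mod_lt _ hpos, Nat.div_add_mod]

theorem sum_block (ω : ℕ → Φ.Symb) {w : ℕ} (hw : 0 < w) (a : ℕ) (g : Φ.Symb → ℝ) :
    ∑ k ∈ Finset.Ico (w * a) (w * a + w), g (ω k) = w * ∑ e, wordFreq ω w a e * g e := by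
  rw [Finset.sum_Ico_eq_sum_range, Nat.add_sub_cancel_left,
    ← Finset.sum_fiberwise (g := fun u => ω (w * a + u)), Finset.mul_sum]
  refine Finset.sum_congr rfl fun e _ => ?_
  rw [Finset.sum_congr rfl (g := fun _ => g e) fun u hu => by rw [(Finset.mem_filter.1 hu).2],
    Finset.sum_const, wordFreq, wordCount, nsmul_eq_mul]
  field_simp

/-- Over a union of blocks, a block-wise constant observable may be replaced by its average
with respect to the block frequencies. -/
theorem sum_range_eq_sum_blockFreq {L : ℕ} (hL : 2 ≤ L) (ω : ℕ → Φ.Symb) (g : ℕ → Φ.Symb → ℝ)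
    (hg : ∀ k, g (blockStart L k) = g k) {N : ℕ} (hN : blockStart L N = N) :
    ∑ k ∈ Finset.range N, g k (ω k) =
      ∑ k ∈ Finset.range N, ∑ e, blockFreq L ω k e * g k e := by
  have hmap : ∀ k ∈ Finset.range N, blockStart L k ∈ Finset.range N := fun k hk =>
    Finset.mem_range.2 ((blockStart_le L k).trans_lt (Finset.mem_range.1 hk))
  rw [← Finset.sum_fiberwise_of_maps_to hmap fun k => g k (ω k),
    ← Finset.sum_fiberwise_of_maps_to hmap fun k => ∑ e, blockFreq L ω k e * g k e]
  refine Finset.sum_congr rfl fun v hv => ?_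
  by_cases hvs : blockStart L v = v
  · have hfib : (Finset.range N).filter (fun k => blockStart L k = v) =
        Finset.Ico (blockStart L v) (blockStart L v + blockLen L v) := by
      ext k
      simp only [Finset.mem_filter, Finset.mem_range, Finset.mem_Ico]
      constructor
      · rintro ⟨hk, rfl⟩
        rw [blockStart_blockStart hL, blockLen_eq_of_mem_block hL (k := k) le_rfl
          (by have := blockLen_pos hL k; omega)]
        exact ⟨blockStart_le _ _, lt_blockStart_add hL k⟩
      · rintro ⟨h1, h2⟩
        exact ⟨h2.trans_le (block_subset_of_lt hL hN (Finset.mem_range.1 hv)),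
          (blockStart_eq_of_mem_block hL h1 h2).trans hvs⟩
    rw [hfib]
    have hgv : ∀ k ∈ Finset.Ico (blockStart L v) (blockStart L v + blockLen L v), g k = g v := by
      intro k hk
      rw [Finset.mem_Ico] at hk
      rw [← hg k, blockStart_eq_of_mem_block hL hk.1 hk.2, hg]
    rw [Finset.sum_congr rfl fun k hk => congrFun (hgv k hk) (ω k)]
    refine (sum_block ω (blockLen_pos hL v) (v / blockLen L v) (g v)).trans ?_
    have hR : ∑ k ∈ Finset.Ico (blockStart L v) (blockStart L v + blockLen L v),
        ∑ e, blockFreq L ω k e * g k e = blockLen L v * ∑ e, blockFreq L ω v e * g v e := by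
      rw [Finset.sum_congr rfl (g := fun _ => ∑ e, blockFreq L ω v e * g v e) fun k hk => by
        rw [hgv k hk, blockFreq_eq_of_mem_block hL (Finset.mem_Ico.1 hk).1 (Finset.mem_Ico.1 hk).2],
        Finset.sum_const, Nat.card_Ico, nsmul_eq_mul, Nat.add_sub_cancel_left]
    rw [hR]
    rfl
  · have hfib : (Finset.range N).filter (fun k => blockStart L k = v) = ∅ := by
      refine Finset.filter_eq_empty_iff.2 fun k _ h => hvs ?_
      rw [← h, blockStart_blockStart hL]
    rw [hfib, Finset.sum_empty, Finset.sum_empty]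

end DiagIFS

theorem div_blockLen_lt {L : ℕ} (hL : 2 ≤ L) (k : ℕ) : k / blockLen L k < L ^ 2 := by
  rw [Nat.div_lt_iff_lt_mul (blockLen_pos hL k), blockLen, ← pow_add]
  exact (Nat.lt_pow_succ_log_self (by omega) k).trans_le (Nat.pow_le_pow_right (by omega) (by omega))

theorem pow_le_blockStart {L : ℕ} (hL : 2 ≤ L) {J k : ℕ} (hk : L ^ J ≤ k) :
    L ^ J ≤ blockStart L k := by
  by_contra! h
  have h1 := block_subset_of_lt hL (blockStart_pow hL J) h
  rw [blockStart_blockStart hL, blockLen_eq_of_mem_block hL (k := k) le_rfl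
    (by have := blockLen_pos hL k; omega)] at h1
  have := lt_blockStart_add hL k
  omega

namespace DiagIFS

variable {Φ : DiagIFS d A}

/-- The active coordinates, frozen along each block. -/
noncomputable def blockActive (Φ : DiagIFS d A) (L : ℕ) (ω : ℕ → Φ.Symb) (n k : ℕ) :
    Finset (Fin d) :=
  Φ.active ω n (blockStart L k)

/-- The approximate cube of level `n` around `ω`. -/
noncomputable def blockCube (Φ : DiagIFS d A) (L : ℕ) (ω : ℕ → Φ.Symb) (n : ℕ) :
    Set (ℕ → Φ.Symb) :=
  Φ.agree (Φ.blockActive L ω n) ω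

/-- The entropy collected up to time `N` by the block frequencies of `ω` on its level `n` cube. -/
noncomputable def blockEntropy (Φ : DiagIFS d A) (L : ℕ) (ω : ℕ → Φ.Symb) (n N : ℕ) : ℝ :=
  ∑ k ∈ Finset.range N, Φ.entropy (Φ.blockActive L ω n k) (blockFreq L ω k)

theorem measurableSet_agree (I : ℕ → Finset (Fin d)) (ω : ℕ → Φ.Symb) :
    MeasurableSet (Φ.agree I ω) := by
  have h : Φ.agree I ω = ⋂ k, (fun σ : ℕ → Φ.Symb => σ k) ⁻¹'
      {a | ∀ i ∈ I k, a.1 i = (ω k).1 i} := by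
    ext σ; simp [agree]
  rw [h]
  exact MeasurableSet.iInter fun k => measurable_pi_apply k (MeasurableSet.of_discrete)

theorem Valid.blockCube_subset (hV : Φ.Valid) (L : ℕ) (ω : ℕ → Φ.Symb) (n : ℕ) :
    Φ.blockCube L ω n ⊆ Φ.agree (Φ.active ω n) ω :=
  agree_anti (fun k => hV.active_anti ω n (blockStart_le L k)) ω

theorem Valid.blockCube_eq_of_mem (hV : Φ.Valid) {L : ℕ} {ω σ : ℕ → Φ.Symb} {n : ℕ}
    (h : σ ∈ Φ.blockCube L ω n) : Φ.blockCube L σ n = Φ.blockCube L ω n := by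
  have hact : Φ.blockActive L σ n = Φ.blockActive L ω n := by
    funext k
    exact hV.active_eq_of_mem (hV.blockCube_subset L ω n h) _
  ext τ
  rw [blockCube, blockCube, hact]
  exact forall_congr' fun k => forall₂_congr fun i hi => by rw [h k i hi]

theorem Valid.blockCube_disjoint (hV : Φ.Valid) {L : ℕ} {ω σ : ℕ → Φ.Symb} {n : ℕ}
    (h : Φ.blockCube L σ n ≠ Φ.blockCube L ω n) :
    Disjoint (Φ.blockCube L σ n) (Φ.blockCube L ω n) := by
  rw [Set.disjoint_left]
  intro τ h1 h2
  exact h ((hV.blockCube_eq_of_mem h1).symm.trans (hV.blockCube_eq_of_mem h2))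

theorem RateBound.blockEntropy_le {c C : ℝ} (h : Φ.RateBound c C) {L : ℕ} (hL : 2 ≤ L)
    (ω : ℕ → Φ.Symb) {n V : ℕ} (hV : 2 * (n : ℝ) ≤ c * V) (N : ℕ) :
    Φ.blockEntropy L ω n N ≤ Φ.blockEntropy L ω n V := by
  have hnn : ∀ k, 0 ≤ Φ.entropy (Φ.blockActive L ω n k) (blockFreq L ω k) := fun k =>
    entropy_nonneg (isProbVec_blockFreq hL ω k) _
  calc Φ.blockEntropy L ω n N ≤ Φ.blockEntropy L ω n (max N V) :=
        Finset.sum_le_sum_of_subset_of_nonneg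
          (Finset.range_subset_range.2 (le_max_left _ _)) fun k _ _ => hnn k
    _ = Φ.blockEntropy L ω n V := by
        refine (Finset.sum_subset (Finset.range_subset_range.2 (le_max_right _ _))
          fun k _ hk => ?_).symm
        rw [Finset.mem_range, not_lt] at hk
        rw [blockActive, h.active_eq_empty, entropy_empty (isProbVec_blockFreq hL ω k)]
        have h1 : (k : ℝ) ≤ 2 * blockStart L k := by exact_mod_cast le_two_mul_blockStart hL k
        have h2 : (V : ℝ) ≤ k := by exact_mod_cast hk
        nlinarith [h.pos]

theorem RateBound.pathMeas_blockCube {c C : ℝ} (h : Φ.RateBound c C) {L : ℕ} (hL : 2 ≤ L)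
    (ω : ℕ → Φ.Symb) {n J : ℕ} (hJ : (n : ℝ) ≤ c * (L ^ J : ℕ)) (p : ℕ → Φ.ProbVec)
    (hp : ∀ k < L ^ J, (p k).1 = blockFreq L ω k) :
    (pathMeas p).real (Φ.blockCube L ω n) = Real.exp (-Φ.blockEntropy L ω n (L ^ J)) := by
  rw [blockCube, pathMeas_agree (N := L ^ J)]
  · have hpos : ∀ k ∈ Finset.range (L ^ J),
        Φ.cylMass (Φ.blockActive L ω n k) (p k).1 (ω k) =
          Real.exp (-Φ.info (Φ.blockActive L ω n k) (blockFreq L ω k) (ω k)) := by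
      intro k hk
      rw [hp k (Finset.mem_range.1 hk), info, neg_neg, Real.exp_log]
      exact (blockFreq_pos hL ω k).trans_le (le_cylMass (isProbVec_blockFreq hL ω k) _ _)
    rw [Finset.prod_congr rfl hpos, ← Real.exp_sum, Finset.sum_neg_distrib, blockEntropy]
    congr 2
    simp only [entropy_eq_sum_info]
    refine sum_range_eq_sum_blockFreq hL ω
      (fun k => Φ.info (Φ.blockActive L ω n k) (blockFreq L ω k)) (fun k => ?_) (blockStart_pow hL J)
    have h1 : blockFreq L ω (blockStart L k) = blockFreq L ω k :=
      blockFreq_eq_of_mem_block hL le_rfl (by have := blockLen_pos hL k; omega) ω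
    simp only [blockActive, blockStart_blockStart hL, h1]
  · intro k hk
    refine h.active_eq_empty ω (hJ.trans ?_)
    exact mul_le_mul_of_nonneg_left (by exact_mod_cast pow_le_blockStart hL hk) h.pos.le

theorem wordCount_le (ω : ℕ → Φ.Symb) (w a : ℕ) (e : Φ.Symb) : wordCount ω w a e ≤ w :=
  (Finset.card_filter_le _ _).trans_eq (Finset.card_range w)

/-- The number of level `n` cubes collecting entropy at most `s` is at most `exp s` times the
number of possible block frequencies. -/
theorem RateBound.card_blockCube_le {c C : ℝ} (h : Φ.RateBound c C) (hV : Φ.Valid) {L : ℕ}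
    (hL : 2 ≤ L) {n J : ℕ} (hJ : (n : ℝ) ≤ c * (L ^ J : ℕ)) (s : ℝ)
    (D : Finset (Set (ℕ → Φ.Symb)))
    (hD : ∀ q ∈ D, ∃ ω, Φ.blockCube L ω n = q ∧ Φ.blockEntropy L ω n (L ^ J) ≤ s) :
    (D.card : ℝ) ≤
      ((L ^ J + 1) ^ ((J + 1) * (L ^ 2 * Fintype.card Φ.Symb)) : ℕ) * Real.exp s := by
  have : Nonempty Φ.Symb := hV.1.to_subtype
  choose! rep hrep hent using hD
  have hlt : ∀ (q : Set (ℕ → Φ.Symb)) (l : Fin (J + 1)) (a : Fin (L ^ 2)) (e : Φ.Symb),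
      wordCount (rep q) (L ^ ((l : ℕ) - 1)) a e < L ^ J + 1 := fun q l a e =>
    Nat.lt_succ_of_le ((wordCount_le _ _ _ _).trans
      (Nat.pow_le_pow_right (by omega) (by have := l.2; omega)))
  let typ : Set (ℕ → Φ.Symb) → (Fin (J + 1) × (Fin (L ^ 2) × Φ.Symb) → Fin (L ^ J + 1)) :=
    fun q x => ⟨_, hlt q x.1 x.2.1 x.2.2⟩
  have hcard : Fintype.card (Fin (J + 1) × (Fin (L ^ 2) × Φ.Symb) → Fin (L ^ J + 1)) =
      (L ^ J + 1) ^ ((J + 1) * (L ^ 2 * Fintype.card Φ.Symb)) := by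
    simp [Fintype.card_pi, Fintype.card_prod]
  have hfib : ∀ t, ((D.filter fun q => typ q = t).card : ℝ) ≤ Real.exp s := by
    intro t
    rcases (D.filter fun q => typ q = t).eq_empty_or_nonempty with h0 | ⟨q₀, hq₀⟩
    · rw [h0]; simpa using (Real.exp_pos s).le
    let p : ℕ → Φ.ProbVec := fun k => ⟨_, isProbVec_blockFreq hL (rep q₀) k⟩
    have hp : ∀ q ∈ D.filter (fun q => typ q = t), ∀ k < L ^ J,
        (p k).1 = blockFreq L (rep q) k := by
      intro q hq k hk
      have heq : typ q₀ = typ q :=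
        (Finset.mem_filter.1 hq₀).2.trans (Finset.mem_filter.1 hq).2.symm
      funext e
      have hl : Nat.log L k < J + 1 := by
        rcases Nat.eq_zero_or_pos k with rfl | hk0
        · simp
        · exact (Nat.log_lt_of_lt_pow hk0.ne' hk).trans (Nat.lt_succ_self J)
      have := congrArg Fin.val (congrFun heq (⟨_, hl⟩, ⟨_, div_blockLen_lt hL k⟩, e))
      simp only [typ] at this
      simp only [p, blockFreq, wordFreq]
      congr 1
      exact_mod_cast this
    have hmass : ∀ q ∈ D.filter (fun q => typ q = t), Real.exp (-s) ≤ (pathMeas p).real q := by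
      intro q hq
      have hqD := (Finset.mem_filter.1 hq).1
      have := h.pathMeas_blockCube hL (rep q) hJ p (hp q hq)
      rw [hrep q hqD] at this
      rw [this]
      exact Real.exp_le_exp.2 (neg_le_neg (hent q hqD))
    have hdisj : Set.PairwiseDisjoint (↑(D.filter fun q => typ q = t))
        (id : Set (ℕ → Φ.Symb) → Set (ℕ → Φ.Symb)) := by
      intro q hq q' hq' hne
      have h1 := hrep q (Finset.mem_filter.1 hq).1
      have h2 := hrep q' (Finset.mem_filter.1 hq').1
      have := hV.blockCube_disjoint (L := L) (n := n) (σ := rep q) (ω := rep q')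
        (by rw [h1, h2]; exact hne)
      rwa [h1, h2] at this
    have hmeas : ∀ q ∈ D.filter (fun q => typ q = t), MeasurableSet (id q) := by
      intro q hq
      rw [id, ← hrep q (Finset.mem_filter.1 hq).1]
      exact measurableSet_agree _ _
    have h1 : ∑ q ∈ D.filter (fun q => typ q = t), (pathMeas p).real (id q) ≤ 1 := by
      rw [← measureReal_biUnion_finset hdisj hmeas]
      exact measureReal_le_one
    have h2 := Finset.card_nsmul_le_sum _ _ _ hmass
    rw [nsmul_eq_mul, Real.exp_neg, ← div_eq_mul_inv, div_le_iff₀ (Real.exp_pos s)] at h2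
    refine h2.trans (mul_le_of_le_one_left (Real.exp_pos s).le h1)
  rw [Finset.card_eq_sum_card_fiberwise (f := typ) (t := Finset.univ) fun _ _ => by simp, ← hcard]
  push_cast
  calc _ ≤ ∑ _t : Fin (J + 1) × (Fin (L ^ 2) × Φ.Symb) → Fin (L ^ J + 1), Real.exp s :=
        Finset.sum_le_sum fun t _ => hfib t
    _ = _ := by rw [Finset.sum_const, nsmul_eq_mul, Finset.card_univ]

end DiagIFS

theorem exists_sq_le_mul_pow {L : ℕ} (hL : 2 ≤ L) {ε : ℝ} (hε : 0 < ε) :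
    ∃ B : ℝ, 0 ≤ B ∧ ∀ J : ℕ, ((J : ℝ) + 1) ^ 2 ≤ ε * (L : ℝ) ^ J + B := by
  have hL' : (1 : ℝ) < L := by exact_mod_cast hL
  have h := (tendsto_pow_const_div_const_pow_of_one_lt 2 hL').comp (tendsto_add_atTop_nat 1)
  have hev : ∀ᶠ J : ℕ in atTop, ((J : ℝ) + 1) ^ 2 ≤ ε * (L : ℝ) ^ J := by
    filter_upwards [h.eventually_le_const (show 0 < ε / L by positivity)] with J hJ
    simp only [Function.comp, Nat.cast_add, Nat.cast_one] at hJ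
    rw [div_le_iff₀ (by positivity)] at hJ
    refine hJ.trans_eq ?_
    rw [pow_succ]
    field_simp
  obtain ⟨J₀, hJ₀⟩ := eventually_atTop.1 hev
  refine ⟨((J₀ : ℝ) + 1) ^ 2, by positivity, fun J => ?_⟩
  rcases le_total J₀ J with h | h
  · have := hJ₀ J h
    nlinarith [sq_nonneg ((J₀ : ℝ) + 1)]
  · have h1 : ((J : ℝ) + 1) ^ 2 ≤ ((J₀ : ℝ) + 1) ^ 2 := by gcongr
    have h2 : 0 ≤ ε * (L : ℝ) ^ J := by positivity
    linarith

theorem exists_pow_level_le {L : ℕ} (hL : 2 ≤ L) {c : ℝ} (hc : 0 < c) (D : ℕ) {ε : ℝ}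
    (hε : 0 < ε) : ∃ B : ℝ, 0 < B ∧ ∀ n : ℕ, ∃ J : ℕ, (n : ℝ) ≤ c * (L ^ J : ℕ) ∧
      (((L ^ J + 1) ^ ((J + 1) * D) : ℕ) : ℝ) ≤ B * Real.exp (ε * n) := by
  have hL' : (1 : ℝ) < L := by exact_mod_cast hL
  have hlog : 0 < Real.log L := Real.log_pos hL'
  set P := Real.log L * D with hP
  have hP0 : 0 ≤ P := by positivity
  obtain ⟨B, hB0, hB⟩ := exists_sq_le_mul_pow hL (show 0 < ε * c / (P * L + 1) by positivity)
  refine ⟨Real.exp (P * B + 2 * ε * c), Real.exp_pos _, fun n => ?_⟩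
  set m := ⌈(n : ℝ) / c⌉₊ with hm
  have hm1 : (n : ℝ) ≤ c * m := by
    have := Nat.le_ceil ((n : ℝ) / c); rwa [div_le_iff₀' hc] at this
  have hm2 : c * m ≤ n + c := by
    have := (Nat.ceil_lt_add_one (show 0 ≤ (n : ℝ) / c by positivity)).le
    rw [← hm] at this
    calc c * m ≤ c * (n / c + 1) := by gcongr
      _ = n + c := by field_simp
  have hpow : ((L : ℝ) ^ Nat.log L m) ≤ m + 1 := by
    rcases Nat.eq_zero_or_pos m with h0 | h0
    · rw [h0]; simp
    · have : L ^ Nat.log L m ≤ m := Nat.pow_log_le_self L h0.ne'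
      have : ((L ^ Nat.log L m : ℕ) : ℝ) ≤ m := by exact_mod_cast this
      push_cast at this; linarith
  refine ⟨Nat.log L m + 1, ?_, ?_⟩
  · refine hm1.trans ?_
    gcongr
    exact (Nat.lt_pow_succ_log_self (by omega) m).le
  · set J := Nat.log L m + 1 with hJ
    have h1 : L ^ J + 1 ≤ L ^ (J + 1) := by
      have : 1 ≤ L ^ J := Nat.one_le_pow _ _ (by omega)
      rw [pow_succ L J]; nlinarith
    have h2 : (((L ^ J + 1) ^ ((J + 1) * D) : ℕ) : ℝ) ≤ Real.exp (P * ((J : ℝ) + 1) ^ 2) := by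
      calc (((L ^ J + 1) ^ ((J + 1) * D) : ℕ) : ℝ)
          ≤ (((L ^ (J + 1)) ^ ((J + 1) * D) : ℕ) : ℝ) := by
            exact_mod_cast Nat.pow_le_pow_left h1 _
        _ = (L : ℝ) ^ ((J + 1) * ((J + 1) * D)) := by push_cast; rw [← pow_mul]
        _ = Real.exp (P * ((J : ℝ) + 1) ^ 2) := by
            nth_rewrite 1 [← Real.exp_log (show (0 : ℝ) < L by linarith)]
            rw [← Real.exp_nat_mul, hP]
            congr 1
            push_cast; ring
    refine h2.trans ?_
    rw [← Real.exp_add, Real.exp_le_exp]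
    have h3 : (L : ℝ) ^ J ≤ L * (m + 1) := by
      rw [hJ, pow_succ, mul_comm]; gcongr
    have h4 : P * (ε * c / (P * L + 1) * (L : ℝ) ^ J) ≤ ε * (c * (m + 1)) := by
      calc P * (ε * c / (P * L + 1) * (L : ℝ) ^ J)
          ≤ P * (ε * c / (P * L + 1) * (L * (m + 1))) := by gcongr
        _ = (P * L / (P * L + 1)) * (ε * (c * (m + 1))) := by field_simp
        _ ≤ 1 * (ε * (c * (m + 1))) := by
            gcongr
            rw [div_le_one (by positivity)]; linarith
        _ = _ := one_mul _
    have h5 : ε * (c * (m + 1)) ≤ ε * (n + 2 * c) := by gcongr; linarith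
    calc P * ((J : ℝ) + 1) ^ 2 ≤ P * (ε * c / (P * L + 1) * (L : ℝ) ^ J + B) := by
          gcongr; exact hB J
      _ ≤ P * B + 2 * ε * c + ε * n := by linarith

namespace DiagIFS

variable {Φ : DiagIFS d A}

/-- Below the Hausdorff dimension, some sequence collects more entropy than `s * n` on its
level `n` cubes for all large `n`. -/
theorem RateBound.exists_blockEntropy_gt {c C : ℝ} (h : Φ.RateBound c C) (hV : Φ.Valid) {L : ℕ}
    (hL : 2 ≤ L) {s : ℝ} (hs : 0 ≤ s) (hdim : ENNReal.ofReal s < dimH Φ.limitSet) :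
    ∃ ω, ∃ N₀ : ℕ, ∀ n ≥ N₀, ∀ V : ℕ, 2 * (n : ℝ) ≤ c * V → s * n < Φ.blockEntropy L ω n V := by
  by_contra! hcon
  obtain ⟨t, ht0, hst, htd⟩ := ENNReal.lt_iff_exists_real_btwn.1 hdim
  have hst : s < t := (ENNReal.ofReal_lt_ofReal_iff_of_nonneg hs).1 hst
  set ε := (t - s) / 2 with hε
  have hε0 : 0 < ε := by linarith
  obtain ⟨B, hB0, hB⟩ := exists_pow_level_le hL h.pos (L ^ 2 * Fintype.card Φ.Symb) hε0
  let Q : ℕ → Set (Set (ℕ → Φ.Symb)) := fun n =>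
    {q | ∃ ω, Φ.blockCube L ω n = q ∧ ∃ V : ℕ, 2 * (n : ℝ) ≤ c * V ∧
      Φ.blockEntropy L ω n V ≤ s * n}
  have hcard : ∀ n (D : Finset (Set (ℕ → Φ.Symb))), ↑D ⊆ Q n →
      (D.card : ℝ) ≤ B * Real.exp ((ε + s) * n) := by
    intro n D hD
    obtain ⟨J, hJ, hJB⟩ := hB n
    have := h.card_blockCube_le hV hL hJ (s * n) D fun q hq => by
      obtain ⟨ω, hω, V, hV, hle⟩ := hD hq
      exact ⟨ω, hω, (h.blockEntropy_le hL ω hV _).trans hle⟩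
    refine this.trans ?_
    calc _ ≤ B * Real.exp (ε * n) * Real.exp (s * n) :=
          mul_le_mul_of_nonneg_right hJB (Real.exp_pos _).le
      _ = _ := by rw [add_mul ε, Real.exp_add, mul_assoc]
  have hfin : ∀ n, (Q n).Finite := by
    intro n
    by_contra hinf
    obtain ⟨D, hD, hDc⟩ := Set.Infinite.exists_subset_card_eq hinf
      (⌈B * Real.exp ((ε + s) * n)⌉₊ + 1)
    have h1 := hcard n D hD
    have h2 := Nat.le_ceil (B * Real.exp ((ε + s) * n))
    rw [hDc] at h1
    push_cast at h1
    linarith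
  have hcount : ∀ n, Countable (Q n) := fun n => (hfin n).countable.to_subtype
  have hdiam : ∀ n, ∀ q ∈ Q n, ediam (Φ.coding '' q) ≤ ENNReal.ofReal (2 * Real.exp (-n)) := by
    rintro n q ⟨ω, rfl, -⟩
    refine ediam_image_le_iff.2 fun x hx y hy => ?_
    rw [edist_dist]
    refine ENNReal.ofReal_le_ofReal ?_
    have hx' := hV.dist_coding_le (hV.blockCube_subset L ω n hx)
    have hy' := hV.dist_coding_le (hV.blockCube_subset L ω n hy)
    calc _ ≤ _ := dist_triangle_right _ _ (Φ.coding ω)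
      _ ≤ _ := by linarith
  have hexp : Tendsto (fun n : ℕ => ENNReal.ofReal (2 * Real.exp (-n))) atTop (𝓝 0) := by
    have := (Real.tendsto_exp_neg_atTop_nhds_zero.comp tendsto_natCast_atTop_atTop).const_mul
      (2 : ℝ)
    rw [mul_zero] at this
    simpa using ENNReal.tendsto_ofReal this
  have hbound : ∀ N : ℕ, ∑' x : Σ m : ℕ, Q (N + m), ediam (Φ.coding '' x.2.1) ^ t ≤
      ENNReal.ofReal (B * 2 ^ t) * ∑' m : ℕ, ENNReal.ofReal (Real.exp (-ε)) ^ m := by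
    intro N
    rw [ENNReal.tsum_sigma', ← ENNReal.tsum_mul_left]
    refine ENNReal.tsum_le_tsum fun m => ?_
    rw [ENNReal.tsum_eq_iSup_sum]
    refine iSup_le fun D => ?_
    calc ∑ q ∈ D, ediam (Φ.coding '' q.1) ^ t
        ≤ ∑ q ∈ D, ENNReal.ofReal ((2 * Real.exp (-(N + m : ℕ))) ^ t) := by
          refine Finset.sum_le_sum fun q _ => ?_
          rw [← ENNReal.ofReal_rpow_of_nonneg (by positivity) ht0]
          exact ENNReal.rpow_le_rpow (hdiam _ q.1 q.2) ht0
      _ = ENNReal.ofReal (D.card * (2 * Real.exp (-(N + m : ℕ))) ^ t) := by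
          rw [Finset.sum_const, nsmul_eq_mul, ENNReal.ofReal_mul (Nat.cast_nonneg _),
            ENNReal.ofReal_natCast]
      _ ≤ ENNReal.ofReal (B * 2 ^ t * Real.exp (-ε) ^ m) := by
          refine ENNReal.ofReal_le_ofReal ?_
          have h1 := hcard (N + m) (D.map (Function.Embedding.subtype _)) (by
            intro q hq
            simp only [Finset.coe_map, Function.Embedding.subtype_apply, Set.mem_image] at hq
            obtain ⟨x, -, rfl⟩ := hq
            exact x.2)
          rw [Finset.card_map] at h1
          rw [Real.mul_rpow (by norm_num) (Real.exp_pos _).le, ← Real.exp_mul]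
          calc _ ≤ B * Real.exp ((ε + s) * (N + m : ℕ)) *
                (2 ^ t * Real.exp (-(N + m : ℕ) * t)) := by gcongr
            _ = B * 2 ^ t * Real.exp (-ε * (N + m : ℕ)) := by
                have : -ε * ((N + m : ℕ) : ℝ) = (ε + s) * (N + m : ℕ) + -(N + m : ℕ) * t := by
                  rw [hε]; ring
                rw [this, Real.exp_add]; ring
            _ ≤ B * 2 ^ t * Real.exp (m * -ε) := by
                refine mul_le_mul_of_nonneg_left (Real.exp_le_exp.2 ?_) (by positivity)
                push_cast
                nlinarith [(Nat.cast_nonneg N : (0 : ℝ) ≤ N)]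
            _ = _ := by rw [Real.exp_nat_mul]
      _ = _ := by
          rw [ENNReal.ofReal_mul (by positivity), ENNReal.ofReal_pow (Real.exp_pos _).le]
  have hH := Measure.hausdorffMeasure_le_liminf_tsum t Φ.limitSet (l := atTop)
    (fun n : ℕ => ENNReal.ofReal (2 * Real.exp (-n))) hexp
    (fun (N : ℕ) (x : Σ m : ℕ, Q (N + m)) => Φ.coding '' x.2.1)
    (Eventually.of_forall fun N x => (hdiam _ x.2.1 x.2.2).trans (ENNReal.ofReal_le_ofReal (by
      gcongr; omega)))
    (Eventually.of_forall fun N => by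
      rintro _ ⟨ω, rfl⟩
      obtain ⟨n, hn, V, hVn, hle⟩ := hcon ω N
      obtain ⟨m, rfl⟩ := Nat.exists_eq_add_of_le hn
      exact mem_iUnion.2 ⟨⟨m, ⟨_, ω, rfl, V, hVn, hle⟩⟩, ω, mem_agree_self _ _, rfl⟩)
  have hlt : ENNReal.ofReal (B * 2 ^ t) * ∑' m : ℕ, ENNReal.ofReal (Real.exp (-ε)) ^ m < ∞ := by
    refine ENNReal.mul_lt_top ENNReal.ofReal_lt_top ?_
    rw [ENNReal.tsum_geometric, ENNReal.inv_lt_top, tsub_pos_iff_lt, ← ENNReal.ofReal_one]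
    exact (ENNReal.ofReal_lt_ofReal_iff one_pos).2 (Real.exp_lt_one_iff.2 (by linarith))
  have hne : μH[t] Φ.limitSet ≠ ∞ := by
    refine ((hH.trans ?_).trans_lt hlt).ne
    refine (liminf_le_liminf (Eventually.of_forall hbound)).trans ?_
    rw [liminf_const]
  have := dimH_le_of_hausdorffMeasure_ne_top (d := t.toNNReal)
    (by rwa [Real.coe_toNNReal t ht0])
  exact absurd htd (not_lt.2 this)

end DiagIFS

/-- The block profile `W` read off at a real time: at times in `[L^l, L^(l+1))` it takes the
value `W l a` on the `a`-th block of length `L^(l-1)`. -/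
noncomputable def profile {α : Type*} (L : ℕ) (W : ℤ → ℕ → α) (b : ℝ) : α :=
  W ⌊Real.logb L b⌋ ⌊b / (L : ℝ) ^ (⌊Real.logb L b⌋ - 1)⌋₊

theorem measurable_profile (L : ℕ) (W : ℤ → ℕ → ℝ) : Measurable (profile L W) := by
  have h1 : Measurable fun b : ℝ => ⌊Real.logb L b⌋ :=
    Int.measurable_floor.comp (by unfold Real.logb; fun_prop)
  have h2 : Measurable fun b : ℝ => (L : ℝ) ^ (⌊Real.logb L b⌋ - 1) :=
    (measurable_from_top (f := fun z : ℤ => (L : ℝ) ^ (z - 1))).comp h1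
  have h3 : Measurable fun b : ℝ => ⌊b / (L : ℝ) ^ (⌊Real.logb L b⌋ - 1)⌋₊ :=
    Nat.measurable_floor.comp (measurable_id.div h2)
  exact (measurable_of_countable fun z : ℤ × ℕ => W z.1 z.2).comp (h1.prodMk h3)

theorem profile_mul {α : Type*} {L : ℕ} (hL : 2 ≤ L) {W : ℤ → ℕ → α} {m : ℕ}
    (hW : ∀ l, W (l + m) = W l) {b : ℝ} (hb : 0 < b) :
    profile L W ((L : ℝ) ^ m * b) = profile L W b := by
  have hL0 : (0 : ℝ) < L := by positivity
  have hL1 : (L : ℝ) ≠ 1 := by exact_mod_cast (show L ≠ 1 by omega)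
  have h1 : ⌊Real.logb L ((L : ℝ) ^ m * b)⌋ = ⌊Real.logb L b⌋ + m := by
    rw [Real.logb_mul (by positivity) hb.ne', Real.logb_pow, Real.logb_self_eq_one (by
      exact_mod_cast (show 1 < L by omega)), mul_one, add_comm]
    exact Int.floor_add_natCast _ _
  rw [profile, h1, hW, profile]
  congr 2
  rw [show ⌊Real.logb L b⌋ + (m : ℤ) - 1 = m + (⌊Real.logb L b⌋ - 1) by ring, zpow_add₀ hL0.ne',
    zpow_natCast, mul_div_mul_left _ _ (by positivity)]

theorem profile_eq {α : Type*} {L : ℕ} (hL : 2 ≤ L) (W : ℤ → ℕ → α) {k : ℕ} {b : ℝ}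
    (hk : 1 ≤ Nat.log L k) (hb : (blockStart L k : ℝ) ≤ b)
    (hb' : b < blockStart L k + blockLen L k) :
    profile L W b = W (Nat.log L k) (k / blockLen L k) := by
  have hb0 : 0 ≤ b := (Nat.cast_nonneg _).trans hb
  have h1 : blockStart L k ≤ ⌊b⌋₊ := Nat.le_floor hb
  have h2 : ⌊b⌋₊ < blockStart L k + blockLen L k := by
    rw [Nat.floor_lt hb0]; exact_mod_cast hb'
  have hlog : ⌊Real.logb L b⌋ = Nat.log L k := by
    rw [Real.floor_logb_natCast hb0, ← log_eq_of_mem_block hL h1 h2]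
    refine Int.log_of_one_le_right L ?_
    have : 1 ≤ blockStart L k := by
      have := le_two_mul_blockStart hL k
      have hk0 : k ≠ 0 := by rintro rfl; simp at hk
      omega
    exact (by exact_mod_cast this : (1 : ℝ) ≤ blockStart L k).trans hb
  rw [profile, hlog]
  congr 1
  have hpos := blockLen_pos hL k
  have hz : (L : ℝ) ^ (((Nat.log L k : ℕ) : ℤ) - 1) = (blockLen L k : ℕ) := by
    rw [blockLen, ← Nat.cast_one, ← Nat.cast_sub hk, zpow_natCast, Nat.cast_pow]
  rw [hz, Nat.floor_div_natCast]
  rw [← blockLen_eq_of_mem_block hL h1 h2, div_blockLen_eq_of_mem_block hL h1 h2,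
    blockLen_eq_of_mem_block hL h1 h2]

namespace DiagIFS

variable {Φ : DiagIFS d A}

/-- Averaging a multiplicatively periodic block profile over the windows `[b, (1+θ)b]` and mixing
with the uniform distribution produces a cycle. -/
theorem Valid.exists_cycle_of_profile (hV : Φ.Valid) {L m : ℕ} (hL : 2 ≤ L) (hm : 0 < m)
    {W : ℤ → ℕ → Φ.Symb → ℝ} (hWm : ∀ l, W (l + m) = W l) (hWp : ∀ l a, IsProbVec (W l a))
    {η θ : ℝ} (hη0 : 0 ≤ η) (hη1 : η ≤ 1) (hθ : 0 < θ) :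
    ∃ c : Cycle Φ, ∀ b > 0, ∀ e, c.r b e = (1 - η) *
      ((θ * b)⁻¹ * ∫ x in b..(1 + θ) * b, profile L W x e) + η / Fintype.card Φ.Symb := by
  have hne : Nonempty Φ.Symb := hV.1.to_subtype
  have hL1 : (1 : ℝ) < L := by exact_mod_cast (show 1 < L by omega)
  have hcard : (0 : ℝ) < Fintype.card Φ.Symb := by exact_mod_cast Fintype.card_pos
  have hp : ∀ x, IsProbVec (profile L W x) := fun x => hWp _ _
  have hmeas : ∀ e, Measurable fun x => profile L W x e := fun e =>
    measurable_profile L fun l a => W l a e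
  have hint : ∀ e a b, IntervalIntegrable (fun x => profile L W x e) volume a b := by
    intro e a b
    refine (intervalIntegrable_const (c := (1 : ℝ))).mono_fun (hmeas e).aestronglyMeasurable ?_
    refine Eventually.of_forall fun x => ?_
    simp only [norm_one, Real.norm_eq_abs, abs_of_nonneg ((hp x).1 e)]
    exact (hp x).le_one e
  refine ⟨{
    lam := (L : ℝ) ^ m
    one_le_lam := one_le_pow₀ hL1.le
    r := fun b e => (1 - η) * ((θ * b)⁻¹ * ∫ x in b..(1 + θ) * b, profile L W x e) +
      η / Fintype.card Φ.Symb
    prob := ?_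
    cont := ?_
    periodic := ?_
    const_of_lam_eq_one := ?_ }, fun _ _ _ => rfl⟩
  · intro b hb
    refine ⟨fun e => ?_, ?_⟩
    · have : 0 ≤ ∫ x in b..(1 + θ) * b, profile L W x e :=
        intervalIntegral.integral_nonneg (by nlinarith) fun x _ => (hp x).1 e
      have : 0 ≤ 1 - η := by linarith
      positivity
    · rw [Finset.sum_add_distrib, ← Finset.mul_sum, ← Finset.mul_sum,
        ← intervalIntegral.integral_finsetSum fun e _ => hint e _ _]
      simp only [(hp _).2]
      rw [intervalIntegral.integral_const, Finset.sum_const, Finset.card_univ, nsmul_eq_mul]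
      simp only [smul_eq_mul]
      field_simp
      ring
  · refine continuousOn_pi.2 fun e => ?_
    have hc : Continuous fun x => ∫ t in (0 : ℝ)..x, profile L W t e :=
      intervalIntegral.continuous_primitive (hint e) 0
    have heq : ∀ b : ℝ, ∫ x in b..(1 + θ) * b, profile L W x e =
        (∫ t in (0 : ℝ)..(1 + θ) * b, profile L W t e) - ∫ t in (0 : ℝ)..b, profile L W t e :=
      fun b => (intervalIntegral.integral_interval_sub_left (hint e _ _) (hint e _ _)).symm
    simp only [heq]
    have hc2 : Continuous fun b => ∫ t in (0 : ℝ)..(1 + θ) * b, profile L W t e :=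
      hc.comp (continuous_const.mul continuous_id)
    refine ((ContinuousOn.mul (ContinuousOn.inv₀ (by fun_prop) fun b hb => ?_)
      (hc2.sub hc).continuousOn).const_smul (1 - η)).add continuousOn_const
    exact (mul_pos hθ hb).ne'
  · intro b hb
    funext e
    have hlam : (0 : ℝ) < (L : ℝ) ^ m := by positivity
    have h1 : ∫ x in (L : ℝ) ^ m * b..(1 + θ) * ((L : ℝ) ^ m * b), profile L W x e =
        (L : ℝ) ^ m * ∫ x in b..(1 + θ) * b, profile L W x e := by
      rw [show (1 + θ) * ((L : ℝ) ^ m * b) = (L : ℝ) ^ m * ((1 + θ) * b) by ring,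
        ← intervalIntegral.mul_integral_comp_mul_left]
      congr 1
      refine intervalIntegral.integral_congr fun x hx => ?_
      rw [uIcc_of_le (by nlinarith)] at hx
      exact congrFun (profile_mul hL hWm (hb.trans_le hx.1)) e
    simp only [h1]
    congr 2
    field_simp
  · intro h
    exact absurd h (one_lt_pow₀ hL1 hm.ne').ne'

theorem exists_wordFreq_close (ω : ℕ → Φ.Symb) {L : ℕ} (hL : 2 ≤ L) (l₀ : ℕ) {η : ℝ}
    (hη : 0 < η) : ∃ l₁ m, l₀ ≤ l₁ ∧ 0 < m ∧ ∀ a < L ^ 2, ∀ e,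
      |wordFreq ω (L ^ (l₁ - 1)) a e - wordFreq ω (L ^ (l₁ + m - 1)) a e| ≤ η := by
  let x : ℕ → Fin (L ^ 2) → Φ.Symb → ℝ := fun l a => wordFreq ω (L ^ (l - 1)) a
  have hx : ∀ l, x l ∈ Icc (0 : Fin (L ^ 2) → Φ.Symb → ℝ) 1 := fun l =>
    ⟨fun a e => (isProbVec_wordFreq ω (by positivity) _).1 e,
      fun a e => (isProbVec_wordFreq ω (by positivity) _).le_one e⟩
  obtain ⟨y, -, φ, hφ, hy⟩ := isCompact_Icc.tendsto_subseq hx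
  obtain ⟨N, hN⟩ := Metric.cauchySeq_iff.1 hy.cauchySeq η hη
  set M := max N l₀
  have hlt : φ M < φ (M + 1) := hφ M.lt_succ_self
  refine ⟨φ M, φ (M + 1) - φ M, (le_max_right _ _).trans (hφ.le_apply), by omega, ?_⟩
  intro a ha e
  rw [Nat.add_sub_cancel' hlt.le]
  have h := (hN M (le_max_left _ _) (M + 1) (by omega)).le
  have h2 := (dist_le_pi_dist (x (φ M) ⟨a, ha⟩) (x (φ (M + 1)) ⟨a, ha⟩) e).trans
    ((dist_le_pi_dist (x (φ M)) (x (φ (M + 1))) ⟨a, ha⟩).trans h)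
  rwa [Real.dist_eq] at h2

/-- A cycle following the block frequencies of `ω`, up to a multiplicative time change. -/
theorem Valid.exists_cycle (hV : Φ.Valid) (ω : ℕ → Φ.Symb) {L : ℕ} (hL : 2 ≤ L) {l₀ : ℕ}
    (hl₀ : 3 ≤ l₀) {η : ℝ} (hη0 : 0 < η) (hη1 : η ≤ 1) :
    ∃ l₁ m, l₀ ≤ l₁ ∧ 0 < m ∧ ∃ c : Cycle Φ,
      (∀ b > 0, ∀ e, η / Fintype.card Φ.Symb ≤ c.r b e) ∧
      ∀ j k, m ∣ j → l₁ + j ≤ Nat.log L k → Nat.log L k ≤ l₁ + m + j →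
        k % blockLen L k + L ^ (Nat.log L k - 2) < blockLen L k →
        ∀ e, |c.r ((k : ℝ) + 1) e - blockFreq L ω (k / L ^ j) e| ≤ 2 * η := by
  have hne : Nonempty Φ.Symb := hV.1.to_subtype
  have hcard : (1 : ℝ) ≤ Fintype.card Φ.Symb := by exact_mod_cast Fintype.card_pos
  obtain ⟨l₁, m, hl₁, hm, hclose⟩ := exists_wordFreq_close ω hL l₀ hη0
  let W : ℤ → ℕ → Φ.Symb → ℝ := fun l a => wordFreq ω (L ^ (l₁ + ((l - l₁) % m).toNat - 1)) a
  have hWp : ∀ l a, IsProbVec (W l a) := fun l a => isProbVec_wordFreq ω (by positivity) a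
  have hWm : ∀ l, W (l + m) = W l := fun l => by
    simp only [W]
    rw [show l + (m : ℤ) - l₁ = l - l₁ + m by ring, Int.add_emod_right]
  have hLr : (2 : ℝ) ≤ L := by exact_mod_cast hL
  have hθ : (0 : ℝ) < ((L : ℝ) ^ 4)⁻¹ := by positivity
  obtain ⟨c, hc⟩ := hV.exists_cycle_of_profile hL hm hWm hWp hη0.le hη1 hθ
  refine ⟨l₁, m, hl₁, hm, c, fun b hb e => ?_, fun j k hj hk1 hk2 hgood e => ?_⟩
  · rw [hc b hb]
    have : 0 ≤ ∫ x in b..(1 + ((L : ℝ) ^ 4)⁻¹) * b, profile L W x e :=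
      intervalIntegral.integral_nonneg (by nlinarith) fun x _ => (hWp _ _).1 e
    have : 0 ≤ 1 - η := by linarith
    have : 0 ≤ (1 - η) * ((((L : ℝ) ^ 4)⁻¹ * b)⁻¹ *
        ∫ x in b..(1 + ((L : ℝ) ^ 4)⁻¹) * b, profile L W x e) := by positivity
    linarith
  · set l := Nat.log L k with hl
    obtain ⟨t, ht⟩ : ∃ t, l = t + 3 := ⟨l - 3, by omega⟩
    have hk0 : k ≠ 0 := by rintro rfl; simp at hl; omega
    have hkhi : k < L ^ (l + 1) := Nat.lt_pow_succ_log_self (by omega) k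
    have hk1pos : (0 : ℝ) < (k : ℝ) + 1 := by positivity
    have hrange : ∀ x ∈ Icc ((k : ℝ) + 1) ((1 + ((L : ℝ) ^ 4)⁻¹) * ((k : ℝ) + 1)),
        profile L W x = W l (k / blockLen L k) := by
      intro x hx
      refine profile_eq hL W (by omega) ?_ ?_
      · have : (blockStart L k : ℝ) ≤ k := by exact_mod_cast blockStart_le L k
        linarith [hx.1]
      · have h1 : (k : ℝ) + 1 ≤ (L : ℝ) ^ (t + 4) := by
          rw [ht] at hkhi; exact_mod_cast hkhi
        have h2 : ((L : ℝ) ^ 4)⁻¹ * ((k : ℝ) + 1) ≤ (L : ℝ) ^ t := by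
          rw [inv_mul_le_iff₀ (by positivity), ← pow_add, add_comm 4]; exact h1
        have h3 : (k : ℝ) = blockStart L k + (k % blockLen L k : ℕ) := by
          rw [blockStart]; exact_mod_cast (Nat.div_add_mod k (blockLen L k)).symm
        have h4 : ((k % blockLen L k : ℕ) : ℝ) + (L : ℝ) ^ (t + 1) < blockLen L k := by
          rw [ht] at hgood; exact_mod_cast hgood
        have h5 : 1 + (L : ℝ) ^ t ≤ (L : ℝ) ^ (t + 1) := by
          have : (1 : ℝ) ≤ (L : ℝ) ^ t := one_le_pow₀ (by linarith)
          rw [pow_succ]; nlinarith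
        have := hx.2
        linarith
    have hI : ∫ x in ((k : ℝ) + 1)..(1 + ((L : ℝ) ^ 4)⁻¹) * ((k : ℝ) + 1), profile L W x e =
        ((L : ℝ) ^ 4)⁻¹ * ((k : ℝ) + 1) * W l (k / blockLen L k) e := by
      rw [intervalIntegral.integral_congr (g := fun _ => W l (k / blockLen L k) e) fun x hx => by
        rw [uIcc_of_le (by nlinarith)] at hx
        exact congrFun (hrange x hx) e]
      rw [intervalIntegral.integral_const, smul_eq_mul]
      ring
    rw [hc _ hk1pos, hI, inv_mul_cancel_left₀ (by positivity)]
    have hkj : blockFreq L ω (k / L ^ j) = wordFreq ω (L ^ (l - j - 1)) (k / blockLen L k) := by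
      have hlog : Nat.log L (k / L ^ j) = l - j := Nat.log_div_base_pow L k j
      rw [blockFreq, blockLen, hlog, Nat.div_div_eq_div_mul, ← pow_add, blockLen, ← hl]
      congr 3; omega
    have hdist : |W l (k / blockLen L k) e - blockFreq L ω (k / L ^ j) e| ≤ η := by
      rw [hkj]
      obtain ⟨q, rfl⟩ := hj
      rcases hk2.eq_or_lt with h | h
      · have : (((l : ℕ) : ℤ) - l₁) % m = 0 := by
          rw [h]; push_cast
          rw [show (l₁ : ℤ) + m + m * q - l₁ = m * (1 + q) by ring, Int.mul_emod_right]
        simp only [W, this, Int.toNat_zero, add_zero]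
        rw [show l - m * q - 1 = l₁ + m - 1 by omega]
        exact hclose _ (div_blockLen_lt hL k) e
      · obtain ⟨u, hu⟩ := Nat.exists_eq_add_of_le hk1
        have : (((l : ℕ) : ℤ) - l₁) % m = u := by
          rw [hu]; push_cast
          rw [show (l₁ : ℤ) + m * q + u - l₁ = u + m * q by ring, Int.add_mul_emod_self_left]
          exact Int.emod_eq_of_lt (by positivity) (by omega)
        simp only [W, this, Int.toNat_natCast]
        rw [show l - m * q - 1 = l₁ + u - 1 by omega, sub_self, abs_zero]
        exact hη0.le
    have hW0 := (hWp l (k / blockLen L k)).1 e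
    have hW1 := (hWp l (k / blockLen L k)).le_one e
    have hu0 : 0 ≤ η / Fintype.card Φ.Symb := by positivity
    have hu1 : η / Fintype.card Φ.Symb ≤ η := div_le_self hη0.le hcard
    rw [abs_le] at hdist ⊢
    constructor <;> nlinarith
end DiagIFS

theorem card_filter_le_mod {w : ℕ} (hw : 0 < w) (u N : ℕ) :
    ((Finset.range N).filter fun k => w ≤ k % w + u).card ≤ (N / w + 1) * u := by
  have h := Finset.card_le_card_of_injOn (s := (Finset.range N).filter fun k => w ≤ k % w + u)
    (t := Finset.range (N / w + 1) ×ˢ Finset.range u)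
    (fun k => (k / w, k % w + u - w)) ?_ ?_
  · simpa using h
  · intro k hk
    simp only [Finset.coe_filter, Finset.mem_range, mem_ofPred_eq] at hk
    have := Nat.mod_lt k hw
    have h2 : k / w ≤ N / w := Nat.div_le_div_right hk.1.le
    simp only [Finset.coe_product, Finset.coe_range, mem_prod, mem_Iio]
    omega
  · intro k hk k' hk' h
    simp only [Finset.coe_filter, Finset.mem_range, mem_ofPred_eq] at hk hk'
    simp only [Prod.mk.injEq] at h
    rw [← Nat.div_add_mod k w, ← Nat.div_add_mod k' w, h.1]
    omega

/-- Few times lie close to the end of their block. -/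
theorem card_bad_le {L l K : ℕ} (hL : 2 ≤ L) (hl : 2 ≤ l) (hK : L ^ l ≤ K) (hK' : K ≤ L ^ (l + 2)) :
    (((Finset.Ico (L ^ l) K).filter fun k =>
      ¬ k % blockLen L k + L ^ (Nat.log L k - 2) < blockLen L k).card : ℝ) ≤ 4 * K / L := by
  obtain ⟨e, rfl⟩ : ∃ e, l = e + 2 := ⟨l - 2, by omega⟩
  have hL0 : (0 : ℝ) < L := by positivity
  have hsub : ((Finset.Ico (L ^ (e + 2)) K).filter fun k =>
      ¬ k % blockLen L k + L ^ (Nat.log L k - 2) < blockLen L k) ⊆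
      ((Finset.range K).filter fun k => L ^ (e + 1) ≤ k % L ^ (e + 1) + L ^ e) ∪
      ((Finset.range K).filter fun k => L ^ (e + 2) ≤ k % L ^ (e + 2) + L ^ (e + 1)) := by
    intro k hk
    simp only [Finset.mem_filter, Finset.mem_Ico, not_lt] at hk
    obtain ⟨⟨h1, h2⟩, h3⟩ := hk
    have h4 : e + 2 ≤ Nat.log L k := Nat.le_log_of_pow_le (by omega) h1
    have hk0 : k ≠ 0 := by rintro rfl; simp at h4
    have h5 : Nat.log L k < e + 4 := Nat.log_lt_of_lt_pow hk0 (h2.trans_le hK')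
    simp only [Finset.mem_union, Finset.mem_filter, Finset.mem_range]
    have h6 : Nat.log L k = e + 2 ∨ Nat.log L k = e + 3 := by omega
    rcases h6 with h6 | h6
    · left; simp only [blockLen, h6] at h3; exact ⟨h2, h3⟩
    · right; simp only [blockLen, h6] at h3; exact ⟨h2, h3⟩
  have hone : ∀ f, f ≤ e + 1 →
      ((((Finset.range K).filter fun k => L ^ (f + 1) ≤ k % L ^ (f + 1) + L ^ f).card : ℕ) : ℝ) ≤
        2 * K / L := by
    intro f hf
    have h1 := card_filter_le_mod (show 0 < L ^ (f + 1) by positivity) (L ^ f) K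
    have h2 : (1 : ℝ) ≤ K / (L : ℝ) ^ (f + 1) := by
      rw [one_le_div (by positivity)]
      exact_mod_cast (Nat.pow_le_pow_right (by omega) (by omega)).trans hK
    calc _ ≤ (((K / L ^ (f + 1) + 1) * L ^ f : ℕ) : ℝ) := by exact_mod_cast h1
      _ ≤ (K / (L : ℝ) ^ (f + 1) + K / (L : ℝ) ^ (f + 1)) * (L : ℝ) ^ f := by
        push_cast
        have : ((K / L ^ (f + 1) : ℕ) : ℝ) ≤ K / (L : ℝ) ^ (f + 1) := by
          have := Nat.cast_div_le (α := ℝ) (m := K) (n := L ^ (f + 1))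
          push_cast at this; exact this
        gcongr
      _ = 2 * K / L := by rw [pow_succ]; field_simp; ring
  calc _ ≤ (((((Finset.range K).filter fun k => L ^ (e + 1) ≤ k % L ^ (e + 1) + L ^ e) ∪
      ((Finset.range K).filter fun k => L ^ (e + 2) ≤ k % L ^ (e + 2) + L ^ (e + 1))).card : ℕ) : ℝ) := by
        exact_mod_cast Finset.card_le_card hsub
    _ ≤ 2 * K / L + 2 * K / L := by
        refine le_trans ?_ (add_le_add (hone e (by omega)) (hone (e + 1) le_rfl))
        exact_mod_cast Finset.card_union_le _ _
    _ = _ := by ring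

theorem sum_Ico_le_of_good {L l K k₀ : ℕ} (hL : 2 ≤ L) (hl : 2 ≤ l) (hK : L ^ l ≤ K)
    (hK' : K ≤ L ^ (l + 2)) (hk₀ : k₀ ≤ K) {u v : ℕ → ℝ} {H ε : ℝ} (hH : 0 ≤ H) (hε : 0 ≤ ε)
    (hv : ∀ k, 0 ≤ v k) (hu : ∀ k, u k ≤ H)
    (huv : ∀ k, L ^ l ≤ k → k < K →
      k % blockLen L k + L ^ (Nat.log L k - 2) < blockLen L k → u k ≤ v k + ε) :
    ∑ k ∈ Finset.Ico (L ^ l) k₀, u k ≤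
      ∑ k ∈ Finset.Ico (L ^ l) k₀, v k + ε * K + H * (4 * K / L) := by
  have hpt : ∀ k ∈ Finset.Ico (L ^ l) k₀, u k ≤ v k + ε +
      if ¬ k % blockLen L k + L ^ (Nat.log L k - 2) < blockLen L k then H else 0 := by
    intro k hk
    rw [Finset.mem_Ico] at hk
    split_ifs with h
    · rw [add_zero]; exact huv k hk.1 (hk.2.trans_le hk₀) h
    · linarith [hv k, hu k]
  refine (Finset.sum_le_sum hpt).trans ?_
  rw [Finset.sum_add_distrib, Finset.sum_add_distrib, ← Finset.sum_filter, Finset.sum_const,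
    Finset.sum_const, nsmul_eq_mul, nsmul_eq_mul, Nat.card_Ico, mul_comm ε]
  have h1 := card_bad_le hL hl hK hK'
  have h2 : (((Finset.Ico (L ^ l) k₀).filter fun k =>
      ¬ k % blockLen L k + L ^ (Nat.log L k - 2) < blockLen L k).card : ℝ) ≤ 4 * K / L := by
    refine le_trans ?_ h1
    exact_mod_cast Finset.card_le_card
      (Finset.filter_subset_filter _ (Finset.Ico_subset_Ico_right hk₀))
  have h3 : ((k₀ - L ^ l : ℕ) : ℝ) ≤ K := by exact_mod_cast (Nat.sub_le _ _).trans hk₀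
  rw [mul_comm H]
  gcongr

theorem sum_range_mul_div {w : ℕ} (hw : 0 < w) (f : ℕ → ℝ) (V : ℕ) :
    ∑ k ∈ Finset.range (w * V), f (k / w) = w * ∑ k ∈ Finset.range V, f k := by
  induction V with
  | zero => simp
  | succ V ih =>
    rw [mul_add, mul_one, Finset.sum_range_add, ih, Finset.sum_range_succ, mul_add]
    congr 1
    rw [Finset.sum_congr rfl (g := fun _ => f V) fun u hu => by
      rw [Nat.mul_add_div hw, Nat.div_eq_of_lt (Finset.mem_range.1 hu), add_zero]]
    simp

namespace DiagIFS

variable {Φ : DiagIFS d A}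

/-- Expected contraction rates of a measure following the block frequencies of `ω`. -/
theorem RateBound.sum_chi_le {c C : ℝ} (h : Φ.RateBound c C) {L l j K k₀ : ℕ} (hL : 2 ≤ L)
    (hl : 2 ≤ l) (hjl : j + 1 ≤ l) (hK : L ^ (l + 1) ≤ K) (hK' : K ≤ L ^ (l + 2))
    (hk : L ^ l ≤ k₀) (hk₀ : k₀ ≤ K) (ω : ℕ → Φ.Symb) {q : ℕ → Φ.Symb → ℝ}
    (hq : ∀ k, IsProbVec (q k)) {ε : ℝ} (hε : 0 ≤ ε) (i : Fin d)
    (hclose : ∀ k, L ^ l ≤ k → k < K →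
      k % blockLen L k + L ^ (Nat.log L k - 2) < blockLen L k →
      Φ.chi i (q k) ≤ Φ.chi i (blockFreq L ω (k / L ^ j)) + ε) :
    ∑ k ∈ Finset.range k₀, Φ.chi i (q k) ≤
      (L : ℝ) ^ j * Φ.rateSum i ω (blockStart L (k₀ / L ^ j)) + ε * K + 6 * C * K / L := by
  have hL0 : (0 : ℝ) < L := by positivity
  have hC : 0 ≤ C := zero_le_one.trans h.one_le
  have hw : 0 < L ^ j := by positivity
  have hlK : L ^ l ≤ K := (Nat.pow_le_pow_right (by omega) (by omega)).trans hK
  set k₁ := k₀ / L ^ j with hk₁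
  set N := blockStart L k₁ with hN
  have hlK2 : ((L : ℝ) ^ l) ≤ K / L := by
    rw [le_div_iff₀ hL0, ← pow_succ]; exact_mod_cast hK
  have hχ := fun k => h.chi_nonneg i (isProbVec_blockFreq hL ω k)
  have hχ' := fun k => h.chi_le i (isProbVec_blockFreq hL ω k)
  have h1 : ∑ k ∈ Finset.range (L ^ l), Φ.chi i (q k) ≤ C * (K / L) := by
    refine (Finset.sum_le_sum fun k _ => h.chi_le i (hq k)).trans ?_
    rw [Finset.sum_const, Finset.card_range, nsmul_eq_mul, mul_comm]
    push_cast
    gcongr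
  have h2 := sum_Ico_le_of_good hL hl hlK hK' hk₀ hC hε (fun k => hχ (k / L ^ j))
    (fun k => h.chi_le i (hq k)) hclose
  have h3 : ∑ k ∈ Finset.Ico (L ^ l) k₀, Φ.chi i (blockFreq L ω (k / L ^ j)) ≤
      (L ^ j : ℕ) * ∑ k ∈ Finset.range (k₁ + 1), Φ.chi i (blockFreq L ω k) := by
    rw [← sum_range_mul_div hw]
    refine Finset.sum_le_sum_of_subset_of_nonneg (fun k hk => ?_) fun k _ _ => hχ _
    rw [Finset.mem_Ico] at hk
    exact Finset.mem_range.2 (hk.2.trans (Nat.lt_mul_div_succ k₀ hw))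
  have hNk : N ≤ k₁ := blockStart_le L k₁
  have h4 : ∑ k ∈ Finset.range N, Φ.chi i (blockFreq L ω k) = Φ.rateSum i ω N := by
    rw [rateSum, sum_range_eq_sum_blockFreq hL ω (fun _ => Φ.rate i) (fun _ => rfl)
      (blockStart_blockStart hL k₁)]
    exact Finset.sum_congr rfl fun k _ => chi_eq_sum_rate i _
  have hlog : 1 ≤ Nat.log L k₁ := by
    rw [hk₁, Nat.log_div_base_pow]
    have := Nat.le_log_of_pow_le (show 1 < L by omega) hk
    omega
  have hk1 : k₁ ≠ 0 := by intro h; rw [h] at hlog; simp at hlog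
  have hlen : L * blockLen L k₁ ≤ k₁ := by
    rw [blockLen, ← pow_succ', Nat.sub_add_cancel hlog]
    exact Nat.pow_log_le_self L hk1
  have h5 : ∑ k ∈ Finset.range (k₁ + 1), Φ.chi i (blockFreq L ω k) ≤
      Φ.rateSum i ω N + C * blockLen L k₁ := by
    rw [← Finset.sum_range_add_sum_Ico _ (show N ≤ k₁ + 1 by omega), h4]
    gcongr
    refine (Finset.sum_le_sum fun k _ => hχ' k).trans ?_
    rw [Finset.sum_const, Nat.card_Ico, nsmul_eq_mul, mul_comm]
    gcongr
    have := lt_blockStart_add hL k₁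
    omega
  have h6 : (L : ℝ) ^ j * blockLen L k₁ ≤ K / L := by
    rw [le_div_iff₀ hL0]
    have : L ^ j * (L * blockLen L k₁) ≤ K :=
      (Nat.mul_le_mul_left _ hlen).trans ((Nat.mul_div_le k₀ (L ^ j)).trans hk₀)
    calc (L : ℝ) ^ j * blockLen L k₁ * L = ((L ^ j * (L * blockLen L k₁) : ℕ) : ℝ) := by
          push_cast; ring
      _ ≤ K := by exact_mod_cast this
  rw [← Finset.sum_range_add_sum_Ico _ hk]
  push_cast at h3
  have h7 : (L : ℝ) ^ j * ∑ k ∈ Finset.range (k₁ + 1), Φ.chi i (blockFreq L ω k) ≤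
      (L : ℝ) ^ j * Φ.rateSum i ω N + C * (K / L) := by
    calc _ ≤ (L : ℝ) ^ j * (Φ.rateSum i ω N + C * blockLen L k₁) := by gcongr
      _ = (L : ℝ) ^ j * Φ.rateSum i ω N + C * ((L : ℝ) ^ j * blockLen L k₁) := by ring
      _ ≤ _ := by gcongr
  have h8 : 6 * C * K / L = C * (K / L) + C * (4 * K / L) + C * (K / L) := by ring
  rw [h8]
  linarith

/-- Entropy of a measure following the block frequencies of `ω`. -/
theorem blockEntropy_le_sum_entropy {L l j V : ℕ} (hL : 2 ≤ L)
    (hl : 2 ≤ l) (hK : L ^ (l + 1) ≤ L ^ j * V) (hK' : L ^ j * V ≤ L ^ (l + 2))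
    (ω : ℕ → Φ.Symb) (n : ℕ) {q : ℕ → Φ.Symb → ℝ}
    (hq : ∀ k, IsProbVec (q k)) {ε H : ℝ} (hε : 0 ≤ ε) (hH : 0 ≤ H)
    (hent : ∀ (I : Finset (Fin d)) p, IsProbVec p → Φ.entropy I p ≤ H)
    (hclose : ∀ k, L ^ l ≤ k → k < L ^ j * V →
      k % blockLen L k + L ^ (Nat.log L k - 2) < blockLen L k → ∀ I,
      Φ.entropy I (blockFreq L ω (k / L ^ j)) ≤ Φ.entropy I (q k) + ε) :
    (L : ℝ) ^ j * Φ.blockEntropy L ω n V ≤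
      ∑ k ∈ Finset.Ico (L ^ l) (L ^ j * V), Φ.entropy (Φ.blockActive L ω n (k / L ^ j)) (q k) +
        ε * (L ^ j * V : ℕ) + 5 * H * (L ^ j * V : ℕ) / L := by
  have hL0 : (0 : ℝ) < L := by positivity
  have hw : 0 < L ^ j := by positivity
  set K := L ^ j * V with hKdef
  have hlK : L ^ l ≤ K := (Nat.pow_le_pow_right (by omega) (by omega)).trans hK
  have hlK2 : ((L : ℝ) ^ l) ≤ K / L := by
    rw [le_div_iff₀ hL0, ← pow_succ]; exact_mod_cast hK
  have h0 : (L : ℝ) ^ j * Φ.blockEntropy L ω n V = ∑ k ∈ Finset.range K,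
      Φ.entropy (Φ.blockActive L ω n (k / L ^ j)) (blockFreq L ω (k / L ^ j)) := by
    rw [hKdef, sum_range_mul_div hw fun k => Φ.entropy (Φ.blockActive L ω n k) (blockFreq L ω k),
      Nat.cast_pow, blockEntropy]
  have h1 : ∑ k ∈ Finset.range (L ^ l),
      Φ.entropy (Φ.blockActive L ω n (k / L ^ j)) (blockFreq L ω (k / L ^ j)) ≤ H * (K / L) := by
    refine (Finset.sum_le_sum fun k _ => hent _ _ (isProbVec_blockFreq hL ω _)).trans ?_
    rw [Finset.sum_const, Finset.card_range, nsmul_eq_mul, mul_comm]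
    push_cast
    gcongr
  have h2 := sum_Ico_le_of_good hL hl hlK hK' le_rfl hH hε
    (v := fun k => Φ.entropy (Φ.blockActive L ω n (k / L ^ j)) (q k))
    (fun k => entropy_nonneg (hq k) _)
    (fun k => hent _ _ (isProbVec_blockFreq hL ω _))
    (fun k h1 h2 h3 => hclose k h1 h2 h3 (Φ.blockActive L ω n (k / L ^ j)))
  rw [h0, ← Finset.sum_range_add_sum_Ico _ hlK]
  have h8 : 5 * H * K / L = H * (K / L) + H * (4 * K / L) := by ring
  rw [h8]
  linarith

end DiagIFS

namespace DiagIFS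

variable {Φ : DiagIFS d A}

/-- Hoeffding's inequality for the product measures `pathMeas p`. -/
theorem pathMeas_real_le_exp (p : ℕ → Φ.ProbVec) {f : ℕ → Φ.Symb → ℝ} {a M : ℝ} (hM : 0 < M)
    (hf : ∀ k e, f k e ∈ Icc a (a + M)) {ε : ℝ} (hε : 0 ≤ ε) (K : ℕ) :
    (pathMeas p).real {τ | ε * K ≤ ∑ k ∈ Finset.range K, (f k (τ k) - ∑ e, (p k).1 e * f k e)} ≤
      Real.exp (-(2 * ε ^ 2 / M ^ 2 * K)) := by
  have hmean : ∀ k, ∫ τ, f k (τ k) ∂pathMeas p = ∑ e, (p k).1 e * f k e := fun k => by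
    rw [← integral_vecMeas, ← (measurePreserving_eval_infinitePi (fun k => vecMeas (p k)) k).map_eq]
    exact (integral_map (measurable_pi_apply k).aemeasurable
      (measurable_of_countable _).aestronglyMeasurable).symm
  have hind : ProbabilityTheory.iIndepFun
      (fun k (τ : ℕ → Φ.Symb) => f k (τ k) - ∑ e, (p k).1 e * f k e) (pathMeas p) :=
    ProbabilityTheory.iIndepFun_infinitePi (P := fun k => vecMeas (p k))
      (X := fun k x => f k x - ∑ e, (p k).1 e * f k e) fun k => measurable_of_countable _
  have hsub : ∀ k < K, ProbabilityTheory.HasSubgaussianMGF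
      (fun τ : ℕ → Φ.Symb => f k (τ k) - ∑ e, (p k).1 e * f k e) ((‖a + M - a‖₊ / 2) ^ 2)
      (pathMeas p) := fun k _ => by
    rw [← hmean k]
    exact ProbabilityTheory.hasSubgaussianMGF_of_mem_Icc
      ((measurable_of_countable (f k)).comp (measurable_pi_apply k)).aemeasurable
      (Eventually.of_forall fun τ => hf k (τ k))
  refine (ProbabilityTheory.HasSubgaussianMGF.measure_sum_range_ge_le_of_iIndepFun hind hsub
    (ε := ε * K) (by positivity)).trans (Real.exp_le_exp.2 (le_of_eq ?_))
  rcases Nat.eq_zero_or_pos K with rfl | hK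
  · simp
  have hK : (0 : ℝ) < K := by exact_mod_cast hK
  have : (((‖a + M - a‖₊ / 2) ^ 2 : ℝ≥0) : ℝ) = (M / 2) ^ 2 := by
    push_cast
    rw [add_sub_cancel_left, Real.norm_of_nonneg hM.le]
  rw [this]
  field_simp

/-- If the expected rates along the coordinate sets `J` stay below `n` and the expected
information along `J` exceeds `s * n`, then with high probability the level `n` cube of a
random sequence has mass at most `exp (-s * n)`. -/
theorem RateBound.exists_bad_set {c C : ℝ} (h : Φ.RateBound c C) (p : ℕ → Φ.ProbVec) {δ : ℝ}
    (hδ : 0 < δ) (hp : ∀ k e, δ ≤ (p k).1 e) {n l K : ℕ} (hlK : l ≤ K)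
    (J : ℕ → Finset (Fin d)) {s ε : ℝ} (hε : 0 ≤ ε)
    (hrate : ∀ k₀, l ≤ k₀ → k₀ < K → ∀ i ∈ J k₀,
      ∑ k ∈ Finset.range k₀, Φ.chi i (p k).1 + ε * K ≤ n)
    (hent : s * n + ε * K ≤ ∑ k ∈ Finset.Ico l K, Φ.entropy (J k) (p k).1) :
    ∃ bad : Set (ℕ → Φ.Symb),
      (pathMeas p).real bad ≤ (d * K + 1) * Real.exp (-(2 * ε ^ 2 / (C + |Real.log δ|) ^ 2 * K)) ∧
      ∀ τ ∉ bad, (pathMeas p).real (Φ.agree (Φ.active τ n) τ) ≤ Real.exp (-(s * n)) := by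
  set M := C + |Real.log δ| with hMdef
  have hC := h.one_le
  have hM : 0 < M := by positivity
  let f : Fin d → ℕ → ℕ → Φ.Symb → ℝ := fun i k₀ k e => if k < k₀ then Φ.rate i e else 0
  let g : ℕ → Φ.Symb → ℝ := fun k e => if l ≤ k then -Φ.info (J k) (p k).1 e else 0
  have hcyl : ∀ k I e, δ ≤ Φ.cylMass I (p k).1 e := fun k I e =>
    (hp k e).trans (le_cylMass (p k).2 I e)
  have hinfo : ∀ k I e, Φ.info I (p k).1 e ≤ M := fun k I e => by
    have h1 := Real.log_le_log hδ (hcyl k I e)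
    have h2 := neg_abs_le (Real.log δ)
    simp only [info]
    linarith
  have hf : ∀ i k₀ k e, f i k₀ k e ∈ Icc 0 (0 + M) := fun i k₀ k e => by
    simp only [f]
    split_ifs
    · have h1 := h.lower i e
      have h2 := h.upper i e
      have h3 := abs_nonneg (Real.log δ)
      have h4 := h.pos
      constructor <;> linarith
    · constructor <;> linarith
  have hg : ∀ k e, g k e ∈ Icc (-M) (-M + M) := fun k e => by
    simp only [g]
    split_ifs
    · have h1 := hinfo k (J k) e
      have h2 := info_nonneg (p k).2 (J k) e
      constructor <;> linarith
    · constructor <;> linarith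
  let F : Fin d × ℕ → Set (ℕ → Φ.Symb) := fun x => {τ | ε * K ≤ ∑ k ∈ Finset.range K,
    (f x.1 x.2 k (τ k) - ∑ e, (p k).1 e * f x.1 x.2 k e)}
  let G : Set (ℕ → Φ.Symb) := {τ | ε * K ≤ ∑ k ∈ Finset.range K,
    (g k (τ k) - ∑ e, (p k).1 e * g k e)}
  refine ⟨(⋃ x ∈ (Finset.univ : Finset (Fin d)) ×ˢ Finset.range K, F x) ∪ G, ?_, fun τ hτ => ?_⟩
  · refine (measureReal_union_le _ _).trans ?_
    rw [add_mul, one_mul]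
    refine add_le_add ((measureReal_biUnion_finset_le _ _).trans ?_)
      (pathMeas_real_le_exp p hM hg hε K)
    refine (Finset.sum_le_sum fun x _ => pathMeas_real_le_exp p hM (hf x.1 x.2) hε K).trans ?_
    simp
  · simp only [mem_union, mem_iUnion, not_or, not_exists] at hτ
    obtain ⟨hF, hG⟩ := hτ
    have hact : ∀ k₀ ∈ Finset.Ico l K, J k₀ ⊆ Φ.active τ n k₀ := by
      intro k₀ hk₀ i hi
      rw [Finset.mem_Ico] at hk₀
      have h1 := hF (i, k₀) (by simp [hk₀.2])
      simp only [F, mem_ofPred_eq, not_le, f] at h1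
      have h2 : ∑ k ∈ Finset.range K, ((if k < k₀ then Φ.rate i (τ k) else 0) -
          ∑ e, (p k).1 e * if k < k₀ then Φ.rate i e else 0) =
          ∑ k ∈ Finset.range k₀, (Φ.rate i (τ k) - Φ.chi i (p k).1) := by
        rw [← Finset.sum_subset (Finset.range_subset_range.2 hk₀.2.le)]
        · refine Finset.sum_congr rfl fun k hk => ?_
          simp only [if_pos (Finset.mem_range.1 hk), chi_eq_sum_rate]
        · intro k _ hk
          simp only [if_neg (fun h => hk (Finset.mem_range.2 h)), mul_zero, Finset.sum_const_zero,
            sub_zero]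
      rw [h2, Finset.sum_sub_distrib] at h1
      have h3 := hrate k₀ hk₀.1 hk₀.2 i hi
      rw [mem_active, rateSum]
      linarith
    have h4 : Real.exp (-(∑ k ∈ Finset.Ico l K, Φ.info (J k) (p k).1 (τ k))) =
        ∏ k ∈ Finset.Ico l K, Φ.cylMass (J k) (p k).1 (τ k) := by
      rw [← Finset.sum_neg_distrib, Real.exp_sum]
      refine Finset.prod_congr rfl fun k _ => ?_
      rw [info, neg_neg, Real.exp_log (hδ.trans_le (hcyl _ _ _))]
    refine (pathMeas_agree_le p _ τ (Finset.Ico l K)).trans ?_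
    refine (Finset.prod_le_prod (fun k _ => cylMass_nonneg (p k).2 _ _) fun k hk =>
      cylMass_anti (p k).2 (hact k hk) (τ k)).trans ?_
    rw [← h4, Real.exp_le_exp]
    simp only [G, mem_ofPred_eq, not_le, g] at hG
    have h5 : ∑ k ∈ Finset.range K, ((if l ≤ k then -Φ.info (J k) (p k).1 (τ k) else 0) -
        ∑ e, (p k).1 e * if l ≤ k then -Φ.info (J k) (p k).1 e else 0) =
        ∑ k ∈ Finset.Ico l K, (Φ.entropy (J k) (p k).1 - Φ.info (J k) (p k).1 (τ k)) := by
      rw [← Finset.sum_range_add_sum_Ico _ hlK, Finset.sum_eq_zero, zero_add]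
      · refine Finset.sum_congr rfl fun k hk => ?_
        simp only [if_pos (Finset.mem_Ico.1 hk).1, entropy_eq_sum_info, mul_neg,
          Finset.sum_neg_distrib]
        ring
      · intro k hk
        simp only [if_neg (not_le.2 (Finset.mem_range.1 hk)), mul_zero, Finset.sum_const_zero,
          sub_zero]
    rw [h5, Finset.sum_sub_distrib] at hG
    linarith

theorem exists_poly_mul_exp_le (D : ℝ) {γ : ℝ} (hγ : 0 < γ) :
    ∃ B, ∀ K : ℕ, (D * K + 1) * Real.exp (-(γ * K)) ≤ B * Real.exp (-(γ / 2 * K)) := by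
  refine ⟨|D| * (2 / γ) + 1, fun K => ?_⟩
  have h1 : γ / 2 * K ≤ Real.exp (γ / 2 * K) := by linarith [Real.add_one_le_exp (γ / 2 * K)]
  have h2 : (1 : ℝ) ≤ Real.exp (γ / 2 * K) := Real.one_le_exp (by positivity)
  have h3 : D * K + 1 ≤ (|D| * (2 / γ) + 1) * Real.exp (γ / 2 * K) := by
    have : (K : ℝ) = 2 / γ * (γ / 2 * K) := by field_simp
    have h4 : (K : ℝ) ≤ 2 / γ * Real.exp (γ / 2 * K) := by
      calc (K : ℝ) = 2 / γ * (γ / 2 * K) := this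
        _ ≤ _ := by gcongr
    have h5 : D * K ≤ |D| * (2 / γ * Real.exp (γ / 2 * K)) :=
      (mul_le_mul_of_nonneg_right (le_abs_self D) (Nat.cast_nonneg K)).trans (by gcongr)
    linarith
  calc _ ≤ (|D| * (2 / γ) + 1) * Real.exp (γ / 2 * K) * Real.exp (-(γ * K)) := by gcongr
    _ = _ := by rw [mul_assoc, ← Real.exp_add]; congr 2; ring

/-- A product measure whose level `n` cubes are small with high probability has large
dimension. -/
theorem Valid.le_measDim_of_bad_sets (hV : Φ.Valid) (hB : Φ.Baranski) (p : ℕ → Φ.ProbVec)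
    {s κ γ D : ℝ} (hs : 0 ≤ s) (hκ : 0 < κ) (hγ : 0 < γ) {n₀ : ℕ}
    (hbad : ∀ n ≥ n₀, ∃ K : ℕ, κ * n ≤ K ∧ ∃ bad : Set (ℕ → Φ.Symb),
      (pathMeas p).real bad ≤ (D * K + 1) * Real.exp (-(γ * K)) ∧
      ∀ τ ∉ bad, (pathMeas p).real (Φ.agree (Φ.active τ n) τ) ≤ Real.exp (-(s * n))) :
    ENNReal.ofReal s ≤ measDim ((pathMeas p).map Φ.coding) := by
  obtain ⟨B, hBd⟩ := exists_poly_mul_exp_le D hγ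
  have hB0 : 0 ≤ B := by have := hBd 0; simp at this; linarith
  have hbad' : ∀ n, ∃ bad : Set (ℕ → Φ.Symb), n₀ ≤ n →
      (pathMeas p).real bad ≤ B * Real.exp (-(γ / 2 * κ)) ^ n ∧
      ∀ τ ∉ bad, (pathMeas p).real (Φ.agree (Φ.active τ n) τ) ≤ Real.exp (-(s * n)) := by
    intro n
    by_cases hn : n₀ ≤ n
    · obtain ⟨K, hK, bad, h1, h2⟩ := hbad n hn
      refine ⟨bad, fun _ => ⟨(h1.trans (hBd K)).trans ?_, h2⟩⟩
      rw [← Real.exp_nat_mul]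
      gcongr
      nlinarith
    · exact ⟨∅, fun h => absurd h hn⟩
  choose bad hbad' using hbad'
  have hsum : ∑' n, pathMeas p (bad (n + n₀)) ≠ ∞ := by
    have hgeo : Summable fun n : ℕ => B * Real.exp (-(γ / 2 * κ)) ^ (n + n₀) := by
      simp only [pow_add, ← mul_assoc]
      refine Summable.mul_right _ (Summable.mul_left _ ?_)
      refine summable_geometric_of_lt_one (Real.exp_pos _).le (Real.exp_lt_one_iff.2 ?_)
      have : 0 < γ / 2 * κ := by positivity
      linarith
    refine (lt_of_le_of_lt (ENNReal.tsum_le_tsum fun n => ?_) hgeo.tsum_ofReal_lt_top).ne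
    rw [← ofReal_measureReal]
    exact ENNReal.ofReal_le_ofReal (hbad' (n + n₀) (by omega)).1
  have hae := ae_eventually_notMem hsum
  have hex : ∃ N, pathMeas p {τ | ∀ n ≥ N, τ ∉ bad (n + n₀)} ≠ 0 := by
    by_contra! hcon
    have h0 : pathMeas p (⋃ N, {τ | ∀ n ≥ N, τ ∉ bad (n + n₀)}) = 0 := measure_iUnion_null hcon
    have h1 : pathMeas p (⋃ N, {τ | ∀ n ≥ N, τ ∉ bad (n + n₀)})ᶜ = 0 := by
      refine measure_mono_null (fun τ hτ => ?_) hae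
      intro hev
      obtain ⟨N, hN⟩ := eventually_atTop.1 hev
      exact hτ (mem_iUnion.2 ⟨N, hN⟩)
    have h2 := measure_union_le (μ := pathMeas p) (⋃ N, {τ | ∀ n ≥ N, τ ∉ bad (n + n₀)})
      (⋃ N, {τ | ∀ n ≥ N, τ ∉ bad (n + n₀)})ᶜ
    rw [union_compl_self, measure_univ, h0, h1] at h2
    simp at h2
  obtain ⟨N, hN⟩ := hex
  refine hV.le_measDim_map_coding hB (pathMeas p) hN hs (N := N + n₀) fun τ hτ n hn => ?_
  obtain ⟨m, rfl⟩ : ∃ m, n = m + n₀ := ⟨n - n₀, by omega⟩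
  rw [← ofReal_measureReal]
  exact ENNReal.ofReal_le_ofReal ((hbad' (m + n₀) (by omega)).2 τ (hτ m (by omega)))

end DiagIFS

theorem exists_scales {L l₁ m K₀ : ℕ} (hL : 2 ≤ L) (hm : 0 < m) (hK₀ : L ^ (l₁ + 1) ≤ K₀) :
    ∃ l j V, m ∣ j ∧ l₁ + j ≤ l ∧ l + 1 ≤ l₁ + m + j ∧ L ^ (l + 1) ≤ L ^ j * V ∧
      L ^ j * V ≤ L ^ (l + 2) ∧ K₀ ≤ L ^ j * V ∧ L ^ j * V ≤ 2 * K₀ := by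
  have hL0 : 0 < L := by omega
  have h1 : l₁ + 1 ≤ Nat.log L K₀ := Nat.le_log_of_pow_le (by omega) hK₀
  obtain ⟨t, ht⟩ := Nat.exists_eq_add_of_le h1
  set l := l₁ + t with hl
  have hlog : Nat.log L K₀ = l + 1 := by omega
  have hK0 : K₀ ≠ 0 := by rintro rfl; simp at hlog
  have hlo : L ^ (l + 1) ≤ K₀ := hlog ▸ Nat.pow_log_le_self L hK0
  have hhi : K₀ < L ^ (l + 2) := by
    have := Nat.lt_pow_succ_log_self (show 1 < L by omega) K₀
    rwa [hlog] at this
  set j := m * (t / m) with hj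
  have htm := Nat.div_add_mod t m
  have htm' := Nat.mod_lt t hm
  have hw : 0 < L ^ j := by positivity
  have hlt := Nat.lt_mul_div_succ K₀ hw
  have hjK : L ^ j ≤ K₀ := (Nat.pow_le_pow_right hL0 (by omega)).trans hlo
  have hdiv := Nat.mul_div_le K₀ (L ^ j)
  refine ⟨l, j, K₀ / L ^ j + 1, dvd_mul_right _ _, by omega, by omega, hlo.trans hlt.le, ?_,
    hlt.le, ?_⟩
  · obtain ⟨u, hu⟩ : ∃ u, l + 2 = j + u := ⟨l + 2 - j, by omega⟩
    rw [hu, pow_add] at hhi ⊢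
    exact Nat.mul_le_mul_left _ ((Nat.div_lt_iff_lt_mul hw).2 (by rwa [mul_comm]))
  · rw [mul_add, mul_one]; omega

namespace DiagIFS

variable {Φ : DiagIFS d A}

set_option maxHeartbeats 1000000 in
/-- Pseudo-Bernoulli measures approximate the Hausdorff dimension of the limit set. -/
theorem Valid.exists_cycle_measDim_ge (hV : Φ.Valid) (hB : Φ.Baranski) {s : ℝ} (hs : 0 ≤ s)
    (hdim : ENNReal.ofReal s < dimH Φ.limitSet) :
    ∃ x ∈ pseudoBernoulliDims Φ, ENNReal.ofReal s ≤ x := by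
  have hne : Nonempty Φ.Symb := hV.1.to_subtype
  have hcard : (0 : ℝ) < Fintype.card Φ.Symb := by exact_mod_cast Fintype.card_pos
  obtain ⟨s', hs'0, hss', hs'd⟩ := ENNReal.lt_iff_exists_real_btwn.1 hdim
  have hss' : s < s' := (ENNReal.ofReal_lt_ofReal_iff_of_nonneg hs).1 hss'
  have hs'pos : 0 < s' := hs.trans_lt hss'
  obtain ⟨c, C, h⟩ := hV.exists_rateBound
  obtain ⟨H, hH1, hH⟩ := exists_entropy_le Φ
  have hc := h.pos
  have hc1 := h.le_one
  have hC1 := h.one_le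
  set ε₁ := (s' - s) / (2 * s') with hε₁
  have hε₁pos : 0 < ε₁ := div_pos (by linarith) (by linarith)
  have hε₁le : ε₁ ≤ 1 / 2 := by
    rw [hε₁, div_le_div_iff₀ (by linarith) (by norm_num)]; linarith
  have hε₁s : s' * ε₁ = (s' - s) / 2 := by rw [hε₁]; field_simp
  set κ := 6 / c with hκ
  have hκ1 : 6 ≤ κ := by rw [hκ, le_div_iff₀ hc]; linarith
  set ρ := min ε₁ ((s' - s) / 2) / κ with hρ
  have hρpos : 0 < ρ := div_pos (lt_min hε₁pos (by linarith)) (by linarith)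
  have hρ1 : ρ * κ ≤ ε₁ := by
    rw [hρ, div_mul_cancel₀ _ (by linarith)]; exact min_le_left _ _
  have hρ2 : ρ * κ ≤ (s' - s) / 2 := by
    rw [hρ, div_mul_cancel₀ _ (by linarith)]; exact min_le_right _ _
  set R := 6 * C + 5 * H + s' with hR
  set ε := ρ / 4 with hε
  have hεpos : 0 < ε := by positivity
  obtain ⟨L, hL2, hLR⟩ : ∃ L : ℕ, 2 ≤ L ∧ 2 * R / ρ ≤ L :=
    ⟨⌈2 * R / ρ⌉₊ + 2, by omega, by push_cast; linarith [Nat.le_ceil (2 * R / ρ)]⟩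
  have hL0 : (0 : ℝ) < L := by positivity
  have hRL : R / L ≤ ρ / 2 := by
    rw [div_le_iff₀ hρpos] at hLR
    rw [div_le_iff₀ hL0]; linarith
  obtain ⟨η₁, hη₁, hmod₁⟩ := exists_modulus_of_continuous
    (f := fun i : Fin d => Φ.chi i) (fun i => continuous_chi i) hεpos
  obtain ⟨η₂, hη₂, hmod₂⟩ := exists_modulus_of_continuous
    (f := fun I : Finset (Fin d) => Φ.entropy I) (fun I => continuous_entropy I) hεpos
  set η := min (min η₁ η₂) 1 / 2 with hη
  have hη0 : 0 < η := by rw [hη]; positivity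
  have hηa : 2 * η ≤ η₁ := by
    have := (min_le_left (min η₁ η₂) 1).trans (min_le_left _ _); linarith
  have hηb : 2 * η ≤ η₂ := by
    have := (min_le_left (min η₁ η₂) 1).trans (min_le_right _ _); linarith
  have hηc : η ≤ 1 := by have := min_le_right (min η₁ η₂) 1; linarith
  obtain ⟨ω, N₀, hω⟩ := h.exists_blockEntropy_gt hV hL2 hs'0 hs'd
  obtain ⟨l₁, m, hl₁, hm, r, hrlow, hrclose⟩ := hV.exists_cycle ω hL2
    (l₀ := ⌈2 * κ * N₀⌉₊ + 3) (by omega) hη0 hηc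
  have hl₁N : 2 * κ * N₀ ≤ (L : ℝ) ^ l₁ := by
    calc 2 * κ * N₀ ≤ (⌈2 * κ * N₀⌉₊ : ℝ) := Nat.le_ceil _
      _ ≤ ((L ^ l₁ : ℕ) : ℝ) := by
        have := (Nat.lt_pow_self (n := l₁) (show 1 < L by omega)).le
        exact_mod_cast (show ⌈2 * κ * N₀⌉₊ ≤ l₁ by omega).trans this
      _ = _ := by push_cast; rfl
  let p : ℕ → Φ.ProbVec := fun k => ⟨r.r ((k : ℝ) + 1), r.prob _ (by positivity)⟩
  refine ⟨_, ⟨r, pathMeas p, isProductMeasure_pathMeas p, rfl⟩, ?_⟩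
  have hδ : 0 < η / Fintype.card Φ.Symb := div_pos hη0 hcard
  refine hV.le_measDim_of_bad_sets hB p (κ := 1) (D := d)
    (γ := 2 * ε ^ 2 / (C + |Real.log (η / Fintype.card Φ.Symb)|) ^ 2)
    (n₀ := L ^ (l₁ + 1)) hs one_pos (by positivity) fun n hn => ?_
  have hn1 : (1 : ℝ) ≤ n := by
    exact_mod_cast (Nat.one_le_pow _ _ (by omega)).trans hn
  have hK₀n : 2 * (n : ℝ) / c ≤ ⌈2 * (n : ℝ) / c⌉₊ := Nat.le_ceil _
  have hnc : (n : ℝ) ≤ n / c := by rw [le_div_iff₀ hc]; nlinarith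
  have hnc' : 2 * (n : ℝ) / c = 2 * (n / c) := by ring
  obtain ⟨l, j, V, hmj, hlj, hlj', hKlo, hKhi, hKK, hKK'⟩ :=
    exists_scales (l₁ := l₁) (K₀ := ⌈2 * (n : ℝ) / c⌉₊) hL2 hm (hn.trans (by
      have : (n : ℝ) ≤ ⌈2 * (n : ℝ) / c⌉₊ := by linarith
      exact_mod_cast this))
  set K := L ^ j * V with hK
  have hKr : (K : ℝ) = (L : ℝ) ^ j * V := by rw [hK]; push_cast; rfl
  have hKge : 2 * (n : ℝ) / c ≤ K := hK₀n.trans (by exact_mod_cast hKK)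
  have hKle : (K : ℝ) ≤ κ * n := by
    have h1 : (K : ℝ) ≤ 2 * (⌈2 * (n : ℝ) / c⌉₊ : ℝ) := by exact_mod_cast hKK'
    have h2 := (Nat.ceil_lt_add_one (show 0 ≤ 2 * (n : ℝ) / c by positivity)).le
    have h3 : κ * n = 6 * (n / c) := by rw [hκ]; ring
    linarith
  have hLj : (0 : ℝ) < (L : ℝ) ^ j := by positivity
  set n' := ⌊n * (1 - ε₁) / (L : ℝ) ^ j⌋₊ with hn'
  have hn'le : (L : ℝ) ^ j * n' ≤ n * (1 - ε₁) := by
    rw [mul_comm, ← le_div_iff₀ hLj]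
    exact Nat.floor_le (div_nonneg (mul_nonneg (by linarith) (by linarith)) hLj.le)
  have hn'ge : n * (1 - ε₁) - (L : ℝ) ^ j ≤ (L : ℝ) ^ j * n' := by
    have := (Nat.lt_floor_add_one (n * (1 - ε₁) / (L : ℝ) ^ j)).le
    rw [div_le_iff₀ hLj] at this
    linarith
  have hKl : (L : ℝ) ^ (l + 1) ≤ K := by exact_mod_cast hKlo
  have hLjK : (L : ℝ) ^ j ≤ K / L := by
    rw [le_div_iff₀ hL0, ← pow_succ]
    exact (pow_le_pow_right₀ (by exact_mod_cast (show 1 ≤ L by omega)) (by omega)).trans hKl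
  have hn'N : N₀ ≤ n' := by
    refine Nat.le_floor ?_
    rw [le_div_iff₀ hLj]
    have h1 : (L : ℝ) ^ l₁ * (L : ℝ) ^ j ≤ κ * n := by
      rw [← pow_add]
      exact ((pow_le_pow_right₀ (by exact_mod_cast (show 1 ≤ L by omega)) (by omega)).trans
        hKl).trans hKle
    have h2 : κ * (N₀ * (L : ℝ) ^ j) ≤ κ * (n * (1 / 2)) := by
      have := (mul_le_mul_of_nonneg_right hl₁N hLj.le).trans h1
      linarith
    have h3 := le_of_mul_le_mul_left h2 (by linarith)
    exact h3.trans (by gcongr; linarith)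
  have hVn : 2 * (n' : ℝ) ≤ c * V := by
    have h1 : 2 * (n : ℝ) ≤ K * c := by rwa [div_le_iff₀ hc] at hKge
    have h2 : (L : ℝ) ^ j * (2 * n') ≤ (L : ℝ) ^ j * (c * V) := by
      rw [hKr] at h1
      have : (n : ℝ) * (1 - ε₁) ≤ n := by nlinarith
      linarith
    exact le_of_mul_le_mul_left h2 hLj
  have hlog : ∀ k, L ^ l ≤ k → k < K → l₁ + j ≤ Nat.log L k ∧ Nat.log L k ≤ l₁ + m + j := by
    intro k h1 h2
    have h3 := Nat.le_log_of_pow_le (show 1 < L by omega) h1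
    have hk0 : k ≠ 0 := by
      rintro rfl
      exact absurd h1 (not_le.2 (by positivity))
    have h4 := Nat.log_lt_of_lt_pow hk0 (h2.trans_le hKhi)
    omega
  have herr : 2 * ε * K + R * K / L ≤ ρ * κ * n := by
    calc 2 * ε * K + R * K / L = (2 * ε + R / L) * K := by ring
      _ ≤ ρ * (κ * n) := by gcongr; linarith
      _ = _ := by ring
  have hKL0 : 0 ≤ (K : ℝ) / L := by positivity
  refine ⟨K, by rw [one_mul]; linarith, h.exists_bad_set p hδ (fun k e => hrlow _ (by positivity) e)
    (l := L ^ l) ((Nat.pow_le_pow_right (by omega) (by omega)).trans hKlo)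
    (fun k => Φ.blockActive L ω n' (k / L ^ j)) hεpos.le ?_ ?_⟩
  · intro k₀ hlk₀ hk₀K i hi
    have h1 := h.sum_chi_le hL2 (j := j) (by omega) (by omega) hKlo hKhi hlk₀ hk₀K.le ω
      (q := fun k => (p k).1) (fun k => (p k).2) hεpos.le i fun k hk1 hk2 hk3 => by
        have := abs_le.1 (hmod₁ i (p k).1 (blockFreq L ω (k / L ^ j)) (p k).2
          (isProbVec_blockFreq hL2 ω _) fun e => (hrclose j k hmj (hlog k hk1 hk2).1
            (hlog k hk1 hk2).2 hk3 e).trans hηa)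
        linarith
    have h2 : Φ.rateSum i ω (blockStart L (k₀ / L ^ j)) ≤ n' := (mem_active.1 hi).le
    have h3 : (L : ℝ) ^ j * Φ.rateSum i ω (blockStart L (k₀ / L ^ j)) ≤ (L : ℝ) ^ j * n' := by
      gcongr
    have h4 : 6 * C * K / L ≤ R * K / L := by
      rw [mul_div_assoc, mul_div_assoc]
      gcongr
      linarith
    have h5 : ρ * κ * n ≤ ε₁ * n := by gcongr
    linarith
  · have h1 := blockEntropy_le_sum_entropy hL2 (show 2 ≤ l by omega) hKlo hKhi ω n'
      (q := fun k => (p k).1) (fun k => (p k).2) hεpos.le (by linarith) hH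
      fun k hk1 hk2 hk3 I => by
        have := abs_le.1 (hmod₂ I (p k).1 (blockFreq L ω (k / L ^ j)) (p k).2
          (isProbVec_blockFreq hL2 ω _) fun e => (hrclose j k hmj (hlog k hk1 hk2).1
            (hlog k hk1 hk2).2 hk3 e).trans hηb)
        linarith
    have h2 := (hω n' hn'N V hVn).le
    have h3 : (L : ℝ) ^ j * (s' * n') ≤ (L : ℝ) ^ j * Φ.blockEntropy L ω n' V := by gcongr
    have h4 : s' * (n * (1 - ε₁) - K / L) ≤ s' * ((L : ℝ) ^ j * n') := by
      gcongr; linarith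
    have h5 : 5 * H * K / L + s' * (K / L) ≤ R * K / L := by
      have : R * K / L = 6 * C * (K / L) + 5 * H * K / L + s' * (K / L) := by rw [hR]; ring
      have : 0 ≤ 6 * C * (K / L) := by positivity
      linarith
    have h6 : ρ * κ * n ≤ (s' - s) / 2 * n := by gcongr
    have h7 : s' * (n * (1 - ε₁)) = s' * n - (s' - s) / 2 * n := by rw [← hε₁s]; ring
    change _ ≤ ∑ k ∈ Finset.Ico (L ^ l) K, _
    linarith

theorem Valid.isClosed_limitSet (hV : Φ.Valid) : IsClosed Φ.limitSet := by
  have hdisc : DiscreteTopology Φ.Symb := ⟨rfl⟩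
  have hcont : Continuous Φ.coding := by
    obtain ⟨c, C, h⟩ := hV.exists_rateBound
    have hc : Real.exp (-c) < 1 := Real.exp_lt_one_iff.2 (neg_lt_zero.2 h.pos)
    refine continuous_pi fun i => continuous_tsum (u := fun n : ℕ => Real.exp (-c) ^ n)
      (fun n => ?_) (summable_geometric_of_lt_one (Real.exp_pos _).le hc) fun n ω => ?_
    · refine Continuous.mul (continuous_finsetProd _ fun k _ => ?_) ?_
      · exact (continuous_of_discreteTopology (f := fun a : Φ.Symb => Φ.slope i (a.1 i))).comp
          (continuous_apply k)
      · exact (continuous_of_discreteTopology (f := fun a : Φ.Symb => Φ.off i (a.1 i))).comp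
          (continuous_apply n)
    · have ho := hV.2.2.2 i ((ω n).1 i) 0 ⟨le_rfl, zero_le_one⟩
      simp only [base, mul_zero, zero_add] at ho
      rw [norm_mul, Real.norm_eq_abs, Real.norm_eq_abs, hV.abs_prod_slope, abs_of_nonneg ho.1,
        ← Real.exp_nat_mul]
      calc _ ≤ Real.exp (-Φ.rateSum i ω n) * 1 := by gcongr; exact ho.2
        _ ≤ _ := by
          rw [mul_one, Real.exp_le_exp]
          linarith [h.mul_le_rateSum i ω n]
  exact (isCompact_range hcont).isClosed

end DiagIFS

/-- The Hausdorff dimension of a Barański sponge equals the supremum of the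
Hausdorff dimensions of its pseudo-Bernoulli measures. -/
theorem dimH_eq_sup_pseudoBernoulliDims {d : ℕ} {A : Fin d → Type} [∀ i, Fintype (A i)]
    (Φ : DiagIFS d A) (hV : Φ.Valid) (hB : Φ.Baranski) :
    dimH Φ.limitSet = sSup (pseudoBernoulliDims Φ) := by
  refine le_antisymm (le_of_forall_lt fun x hx => ?_) (sSup_le ?_)
  · obtain ⟨s, hs, hxs, hsd⟩ := ENNReal.lt_iff_exists_real_btwn.1 hx
    obtain ⟨y, hy, hsy⟩ := hV.exists_cycle_measDim_ge hB hs hsd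
    exact hxs.trans_le (hsy.trans (le_sSup hy))
  · rintro _ ⟨r, μ, hμ, rfl⟩
    have := hμ.1
    refine measDim_le_dimH _ ?_
    rw [Measure.map_apply hV.measurable_coding hV.isClosed_limitSet.measurableSet.compl]
    convert measure_empty (μ := μ)
    exact Set.eq_empty_of_forall_notMem fun ω hω => hω (Φ.coding_mem ω)

end SelfAffineSponge
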